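/- arXiv:1008.2470 — 2 statements merged into one kernel-verified Lean document; each statement's English description precedes it below -/
import Mathlib

section
/- Improved bounds for the smooth component: there exists a constant C, depending only on n, α, T, bounds for A, f and the data and their derivatives (in particular C is independent of ε_1,…,ε_n), such that the smooth component v satisfies, for every (x,t) in the closed rectangle, each i = 1,…,n and each l = 0,1,2,3: |∂^l v_i/∂x^l(x,t)| ≤ C(1 + Σ_{q=i}^{n} B_q(x) / ε_q^{l/2 − 1}), where B_q(x) = exp(−x√(α/ε_q)) + exp(−(1−x)√(α/ε_q)). -/
/-- The partial derivative in the first variable. -/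
noncomputable def dx (F : ℝ → ℝ → ℝ) (x t : ℝ) : ℝ := deriv (fun y => F y t) x

/-- The partial derivative in the second variable. -/
noncomputable def dt (F : ℝ → ℝ → ℝ) (x t : ℝ) : ℝ := deriv (fun s => F x s) t

/-- Joint smoothness of a curried function of two real variables. -/
def Smooth₂ (F : ℝ → ℝ → ℝ) : Prop := ContDiff ℝ (⊤ : ℕ∞) (fun p : ℝ × ℝ => F p.1 p.2)

namespace Smooth₂

variable {F G : ℝ → ℝ → ℝ}

theorem differentiable (hF : Smooth₂ F) : Differentiable ℝ (fun p : ℝ × ℝ => F p.1 p.2) :=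
  ContDiff.differentiable hF (by simp)

theorem continuous (hF : Smooth₂ F) : Continuous (fun p : ℝ × ℝ => F p.1 p.2) :=
  ContDiff.continuous hF

theorem contDiff_left (hF : Smooth₂ F) (t : ℝ) : ContDiff ℝ (⊤ : ℕ∞) (fun y => F y t) :=
  ContDiff.comp (g := fun p : ℝ × ℝ => F p.1 p.2) (f := fun y : ℝ => (y, t)) hF (by fun_prop)

theorem differentiable_left (hF : Smooth₂ F) (t : ℝ) : Differentiable ℝ (fun y => F y t) :=
  (hF.contDiff_left t).differentiable (by simp)

theorem differentiable_right (hF : Smooth₂ F) (x : ℝ) : Differentiable ℝ (fun s => F x s) :=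
  hF.differentiable.comp (f := fun s : ℝ => (x, s)) (by fun_prop)

theorem dx_eq_fderiv (hF : Smooth₂ F) (x t : ℝ) :
    dx F x t = fderiv ℝ (fun p : ℝ × ℝ => F p.1 p.2) (x, t) (1, 0) := by
  have h := (hF.differentiable (x, t)).hasFDerivAt.comp_hasDerivAt (f := fun y : ℝ => (y, t)) x
    ((hasDerivAt_id x).prodMk (hasDerivAt_const x t))
  exact h.deriv

theorem dt_eq_fderiv (hF : Smooth₂ F) (x t : ℝ) :
    dt F x t = fderiv ℝ (fun p : ℝ × ℝ => F p.1 p.2) (x, t) (0, 1) := by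
  have h := (hF.differentiable (x, t)).hasFDerivAt.comp_hasDerivAt (f := fun s : ℝ => (x, s)) t
    ((hasDerivAt_const t x).prodMk (hasDerivAt_id t))
  exact h.deriv

theorem fderiv_apply (hF : Smooth₂ F) (w : ℝ × ℝ) :
    ContDiff ℝ (⊤ : ℕ∞) (fun p => fderiv ℝ (fun p : ℝ × ℝ => F p.1 p.2) p w) :=
  (ContDiff.fderiv_right (m := (⊤ : ℕ∞)) hF (by simp)).clm_apply contDiff_const

protected theorem dx (hF : Smooth₂ F) : Smooth₂ (dx F) := by
  unfold Smooth₂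
  simpa only [hF.dx_eq_fderiv] using hF.fderiv_apply (1, 0)

protected theorem dt (hF : Smooth₂ F) : Smooth₂ (dt F) := by
  unfold Smooth₂
  simpa only [hF.dt_eq_fderiv] using hF.fderiv_apply (0, 1)

theorem dx_dt_comm (hF : Smooth₂ F) : _root_.dx (_root_.dt F) = _root_.dt (_root_.dx F) := by
  funext x t
  have hsymm : IsSymmSndFDerivAt ℝ (fun p : ℝ × ℝ => F p.1 p.2) (x, t) :=
    (ContDiff.contDiffAt hF).isSymmSndFDerivAt (by simpa using WithTop.coe_le_coe.2 (le_top : (2 : ℕ∞) ≤ ⊤))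
  have hd : DifferentiableAt ℝ (fderiv ℝ (fun p : ℝ × ℝ => F p.1 p.2)) (x, t) :=
    (ContDiff.fderiv_right (m := (⊤ : ℕ∞)) hF (by simp)).differentiable (by simp) _
  rw [hF.dt.dx_eq_fderiv, hF.dx.dt_eq_fderiv]
  simp only [hF.dx_eq_fderiv, hF.dt_eq_fderiv, Prod.mk.eta]
  rw [fderiv_clm_apply hd (by fun_prop), fderiv_clm_apply hd (by fun_prop)]
  simpa using hsymm (1, 0) (0, 1)

theorem const (c : ℝ) : Smooth₂ (fun _ _ => c) := contDiff_const

theorem add (hF : Smooth₂ F) (hG : Smooth₂ G) : Smooth₂ (fun x t => F x t + G x t) :=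
  ContDiff.add hF hG

theorem sub (hF : Smooth₂ F) (hG : Smooth₂ G) : Smooth₂ (fun x t => F x t - G x t) :=
  ContDiff.sub hF hG

theorem mul (hF : Smooth₂ F) (hG : Smooth₂ G) : Smooth₂ (fun x t => F x t * G x t) :=
  ContDiff.mul hF hG

theorem neg (hF : Smooth₂ F) : Smooth₂ (fun x t => -F x t) := ContDiff.neg hF

theorem sum {s : Finset ℕ} {H : ℕ → ℝ → ℝ → ℝ} (hH : ∀ j ∈ s, Smooth₂ (H j)) :
    Smooth₂ (fun x t => ∑ j ∈ s, H j x t) :=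
  ContDiff.sum hH

theorem dx_add (hF : Smooth₂ F) (hG : Smooth₂ G) :
    _root_.dx (fun x t => F x t + G x t) = fun x t => _root_.dx F x t + _root_.dx G x t := by
  funext x t
  exact deriv_fun_add (hF.differentiable_left t x) (hG.differentiable_left t x)

theorem dx_sub (hF : Smooth₂ F) (hG : Smooth₂ G) :
    _root_.dx (fun x t => F x t - G x t) = fun x t => _root_.dx F x t - _root_.dx G x t := by
  funext x t
  exact deriv_fun_sub (hF.differentiable_left t x) (hG.differentiable_left t x)

theorem dt_sub (hF : Smooth₂ F) (hG : Smooth₂ G) :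
    _root_.dt (fun x t => F x t - G x t) = fun x t => _root_.dt F x t - _root_.dt G x t := by
  funext x t
  exact deriv_fun_sub (hF.differentiable_right x t) (hG.differentiable_right x t)

theorem dx_mul (hF : Smooth₂ F) (hG : Smooth₂ G) :
    _root_.dx (fun x t => F x t * G x t) =
      fun x t => _root_.dx F x t * G x t + F x t * _root_.dx G x t := by
  funext x t
  exact deriv_fun_mul (hF.differentiable_left t x) (hG.differentiable_left t x)

theorem dx_const_mul (hF : Smooth₂ F) (c : ℝ) :
    _root_.dx (fun x t => c * F x t) = fun x t => c * _root_.dx F x t := by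
  funext x t
  exact deriv_const_mul c (hF.differentiable_left t x)

theorem dx_sum {s : Finset ℕ} {H : ℕ → ℝ → ℝ → ℝ} (hH : ∀ j ∈ s, Smooth₂ (H j)) :
    _root_.dx (fun x t => ∑ j ∈ s, H j x t) = fun x t => ∑ j ∈ s, _root_.dx (H j) x t := by
  funext x t
  exact deriv_fun_sum fun j hj => (hH j hj).differentiable_left t x

end Smooth₂

theorem dx_neg (F : ℝ → ℝ → ℝ) : dx (fun x t => -F x t) = fun x t => -dx F x t := by
  funext x t
  exact deriv.fun_neg

theorem dt_neg (F : ℝ → ℝ → ℝ) : dt (fun x t => -F x t) = fun x t => -dt F x t := by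
  funext x t
  exact deriv.fun_neg

theorem deriv_eq_of_eqOn_Icc {g h : ℝ → ℝ} {a b : ℝ} (hab : a < b) (hg : Differentiable ℝ g)
    (hh : Differentiable ℝ h) (hgh : Set.EqOn g h (Set.Icc a b)) :
    Set.EqOn (deriv g) (deriv h) (Set.Icc a b) := by
  intro x hx
  have hu := uniqueDiffOn_Icc hab x hx
  rw [← (hg x).derivWithin hu, ← (hh x).derivWithin hu]
  exact derivWithin_congr hgh (hgh hx)

theorem iteratedDeriv_two_eq_dx (F : ℝ → ℝ → ℝ) (x t : ℝ) :
    iteratedDeriv 2 (fun y => F y t) x = dx (dx F) x t := by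
  rw [iteratedDeriv_succ, iteratedDeriv_one]; rfl

theorem iteratedDeriv_three_eq_dx (F : ℝ → ℝ → ℝ) (x t : ℝ) :
    iteratedDeriv 3 (fun y => F y t) x = dx (dx (dx F)) x t := by
  rw [iteratedDeriv_succ, iteratedDeriv_succ, iteratedDeriv_one]; rfl

/-- A finite family of smooth functions is uniformly bounded on a closed rectangle. -/
theorem exists_bound_of_smooth₂ (s : Finset ℕ) (T : ℝ) {F : ℕ → ℝ → ℝ → ℝ}
    (hF : ∀ i ∈ s, Smooth₂ (F i)) :
    ∃ K : ℝ, 0 ≤ K ∧ ∀ i ∈ s, ∀ x ∈ Set.Icc (0:ℝ) 1, ∀ t ∈ Set.Icc (0:ℝ) T,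
      |F i x t| ≤ K := by
  have hcomp : IsCompact (Set.Icc (0:ℝ) 1 ×ˢ Set.Icc (0:ℝ) T) := isCompact_Icc.prod isCompact_Icc
  have h : ∀ i, ∃ K : ℝ, 0 ≤ K ∧ (i ∈ s → ∀ x ∈ Set.Icc (0:ℝ) 1, ∀ t ∈ Set.Icc (0:ℝ) T,
      |F i x t| ≤ K) := by
    intro i
    by_cases hi : i ∈ s
    · obtain ⟨K, hK⟩ := hcomp.exists_bound_of_continuousOn (hF i hi).continuous.continuousOn
      exact ⟨|K|, abs_nonneg _, fun _ x hx t ht => (hK (x, t) ⟨hx, ht⟩).trans (le_abs_self K)⟩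
    · exact ⟨0, le_rfl, fun h => absurd h hi⟩
  choose K hK0 hK using h
  exact ⟨∑ i ∈ s, K i, Finset.sum_nonneg fun i _ => hK0 i, fun i hi x hx t ht =>
    (hK i hi x hx t ht).trans (Finset.single_le_sum (fun j _ => hK0 j) hi)⟩

/-- Same for a doubly indexed family. -/
theorem exists_bound_of_smooth₂_matrix (s : Finset ℕ) (T : ℝ) {F : ℕ → ℕ → ℝ → ℝ → ℝ}
    (hF : ∀ i ∈ s, ∀ j ∈ s, Smooth₂ (F i j)) :
    ∃ K : ℝ, 0 ≤ K ∧ ∀ i ∈ s, ∀ j ∈ s, ∀ x ∈ Set.Icc (0:ℝ) 1, ∀ t ∈ Set.Icc (0:ℝ) T,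
      |F i j x t| ≤ K := by
  have h : ∀ i, ∃ K : ℝ, 0 ≤ K ∧ (i ∈ s → ∀ j ∈ s, ∀ x ∈ Set.Icc (0:ℝ) 1,
      ∀ t ∈ Set.Icc (0:ℝ) T, |F i j x t| ≤ K) := by
    intro i
    by_cases hi : i ∈ s
    · obtain ⟨K, hK0, hK⟩ := exists_bound_of_smooth₂ s T (hF i hi)
      exact ⟨K, hK0, fun _ => hK⟩
    · exact ⟨0, le_rfl, fun h => absurd h hi⟩
  choose K hK0 hK using h
  exact ⟨∑ i ∈ s, K i, Finset.sum_nonneg fun i _ => hK0 i, fun i hi j hj x hx t ht =>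
    (hK i hi j hj x hx t ht).trans (Finset.single_le_sum (fun j _ => hK0 j) hi)⟩

theorem deriv_nonpos_of_left_min {g : ℝ → ℝ} {T t : ℝ} (hg : DifferentiableAt ℝ g t) (ht : 0 < t)
    (htT : t ≤ T) (hmin : ∀ s ∈ Set.Icc 0 T, g t ≤ g s) : deriv g t ≤ 0 := by
  have h : Filter.Tendsto (slope g t) (nhdsWithin t (Set.Iio t)) (nhds (deriv g t)) :=
    (hasDerivAt_iff_tendsto_slope.1 hg.hasDerivAt).mono_left
      (nhdsWithin_mono _ fun s hs => ne_of_lt hs)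
  refine le_of_tendsto h ?_
  filter_upwards [Ioo_mem_nhdsLT ht] with s hs
  rw [slope_def_field]
  exact div_nonpos_of_nonneg_of_nonpos
    (sub_nonneg.2 (hmin s ⟨hs.1.le, hs.2.le.trans htT⟩)) (by linarith [hs.2])

theorem deriv_deriv_nonneg_of_isLocalMin {g : ℝ → ℝ} {x : ℝ} (hg : ContinuousAt g x)
    (h : IsLocalMin g x) : 0 ≤ deriv (deriv g) x := by
  by_contra! hneg
  have hmax : IsLocalMax g x := isLocalMax_of_deriv_deriv_neg hneg h.deriv_eq_zero hg
  have hconst : g =ᶠ[nhds x] fun _ => g x := by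
    filter_upwards [h, hmax] with y h₁ h₂ using le_antisymm h₂ h₁
  have : deriv (deriv g) x = 0 := by
    rw [(hconst.deriv).deriv_eq]; simp
  linarith

/-- The operator `ψ ↦ ∂ψ_i/∂t - c_i ∂²ψ_i/∂x² + Σ_j a_ij ψ_j`. -/
noncomputable def parabolicOp (s : Finset ℕ) (c : ℕ → ℝ) (a : ℕ → ℕ → ℝ → ℝ → ℝ)
    (ψ : ℕ → ℝ → ℝ → ℝ) (i : ℕ) (x t : ℝ) : ℝ :=
  dt (ψ i) x t - c i * dx (dx (ψ i)) x t + ∑ j ∈ s, a i j x t * ψ j x t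

/-- Minimum principle for weakly coupled systems; components with `c i = 0` need no side data. -/
theorem nonneg_of_parabolicOp_nonneg {s : Finset ℕ} {T : ℝ} {c : ℕ → ℝ}
    {a : ℕ → ℕ → ℝ → ℝ → ℝ} {ψ : ℕ → ℝ → ℝ → ℝ} (hc : ∀ i ∈ s, 0 ≤ c i)
    (hoff : ∀ i ∈ s, ∀ j ∈ s, i ≠ j → ∀ x ∈ Set.Icc (0:ℝ) 1, ∀ t ∈ Set.Icc (0:ℝ) T,
      a i j x t ≤ 0)
    (hrow : ∀ i ∈ s, ∀ x ∈ Set.Icc (0:ℝ) 1, ∀ t ∈ Set.Icc (0:ℝ) T, 0 < ∑ j ∈ s, a i j x t)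
    (hψ : ∀ i ∈ s, Smooth₂ (ψ i))
    (hbot : ∀ i ∈ s, ∀ x ∈ Set.Icc (0:ℝ) 1, 0 ≤ ψ i x 0)
    (hside : ∀ i ∈ s, ∀ t ∈ Set.Icc (0:ℝ) T, c i = 0 ∨ (0 ≤ ψ i 0 t ∧ 0 ≤ ψ i 1 t))
    (hL : ∀ i ∈ s, ∀ x ∈ Set.Icc (0:ℝ) 1, ∀ t ∈ Set.Icc (0:ℝ) T,
      0 ≤ parabolicOp s c a ψ i x t) :
    ∀ i ∈ s, ∀ x ∈ Set.Icc (0:ℝ) 1, ∀ t ∈ Set.Icc (0:ℝ) T, 0 ≤ ψ i x t := by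
  by_contra! hcon
  obtain ⟨i₁, hi₁, x₁, hx₁, t₁, ht₁, hneg⟩ := hcon
  have hcomp : IsCompact (Set.Icc (0:ℝ) 1 ×ˢ Set.Icc (0:ℝ) T) := isCompact_Icc.prod isCompact_Icc
  have hne : (Set.Icc (0:ℝ) 1 ×ˢ Set.Icc (0:ℝ) T).Nonempty := ⟨(x₁, t₁), hx₁, ht₁⟩
  have hmin : ∀ i : ℕ, ∃ p ∈ Set.Icc (0:ℝ) 1 ×ˢ Set.Icc (0:ℝ) T, i ∈ s →
      ∀ q ∈ Set.Icc (0:ℝ) 1 ×ˢ Set.Icc (0:ℝ) T, ψ i p.1 p.2 ≤ ψ i q.1 q.2 := by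
    intro i
    by_cases hi : i ∈ s
    · obtain ⟨p, hp, h⟩ := hcomp.exists_isMinOn hne (hψ i hi).continuous.continuousOn
      exact ⟨p, hp, fun _ q hq => h hq⟩
    · exact ⟨_, hne.some_mem, fun h => absurd h hi⟩
  choose p hp hpmin using hmin
  obtain ⟨i, hi, himin⟩ := s.exists_min_image (fun i => ψ i (p i).1 (p i).2) ⟨i₁, hi₁⟩
  obtain ⟨hx, ht⟩ := hp i
  set x := (p i).1
  set t := (p i).2
  have hlow : ∀ j ∈ s, ∀ y ∈ Set.Icc (0:ℝ) 1, ∀ r ∈ Set.Icc (0:ℝ) T, ψ i x t ≤ ψ j y r :=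
    fun j hj y hy r hr => (himin j hj).trans (hpmin j hj (y, r) ⟨hy, hr⟩)
  have hlt : ψ i x t < 0 := (hlow i₁ hi₁ x₁ hx₁ t₁ ht₁).trans_lt hneg
  have htpos : 0 < t := by
    refine lt_of_le_of_ne ht.1 fun h0 => ?_
    have := hbot i hi x hx
    rw [h0] at this
    linarith
  have hdt : dt (ψ i) x t ≤ 0 :=
    deriv_nonpos_of_left_min ((hψ i hi).differentiable_right x t) htpos ht.2
      fun r hr => hlow i hi x hx r hr
  have hdiff : 0 ≤ c i * dx (dx (ψ i)) x t := by
    rcases hside i hi t ht with h0 | ⟨h0, h1⟩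
    · simp [h0]
    · refine mul_nonneg (hc i hi) (deriv_deriv_nonneg_of_isLocalMin
        ((hψ i hi).differentiable_left t x).continuousAt ?_)
      have hx0 : 0 < x := lt_of_le_of_ne hx.1 fun h => by rw [← h] at hlt; linarith
      have hx1 : x < 1 := lt_of_le_of_ne hx.2 fun h => by rw [h] at hlt; linarith
      filter_upwards [Icc_mem_nhds hx0 hx1] with y hy using hlow i hi y hy t ht
  have hsum : ∑ j ∈ s, a i j x t * ψ j x t ≤ (∑ j ∈ s, a i j x t) * ψ i x t := by
    rw [Finset.sum_mul]
    refine Finset.sum_le_sum fun j hj => ?_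
    by_cases hij : i = j
    · rw [hij]
    · exact mul_le_mul_of_nonpos_left (hlow j hj x hx t ht) (hoff i hi j hj hij x hx t ht)
  have hprod := mul_neg_of_pos_of_neg (hrow i hi x hx t ht) hlt
  have := hL i hi x hx t ht
  unfold parabolicOp at this
  linarith

theorem parabolicOp_neg (s : Finset ℕ) (c : ℕ → ℝ) (a : ℕ → ℕ → ℝ → ℝ → ℝ)
    (ψ : ℕ → ℝ → ℝ → ℝ) (i : ℕ) (x t : ℝ) :
    parabolicOp s c a (fun j x t => -ψ j x t) i x t = -parabolicOp s c a ψ i x t := by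
  simp only [parabolicOp, dx_neg, dt_neg, mul_neg, Finset.sum_neg_distrib]
  ring

theorem parabolicOp_sub {s : Finset ℕ} (c : ℕ → ℝ) (a : ℕ → ℕ → ℝ → ℝ → ℝ)
    {ψ χ : ℕ → ℝ → ℝ → ℝ} {i : ℕ} (hψ : Smooth₂ (ψ i)) (hχ : Smooth₂ (χ i)) (x t : ℝ) :
    parabolicOp s c a (fun j x t => ψ j x t - χ j x t) i x t =
      parabolicOp s c a ψ i x t - parabolicOp s c a χ i x t := by
  simp only [parabolicOp, hψ.dt_sub hχ, hψ.dx_sub hχ, hψ.dx.dx_sub hχ.dx, mul_sub,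
    Finset.sum_sub_distrib]
  ring

/-- Comparison principle with a barrier `Ψ`. -/
theorem abs_le_of_abs_parabolicOp_le {s : Finset ℕ} {T : ℝ} {c : ℕ → ℝ}
    {a : ℕ → ℕ → ℝ → ℝ → ℝ} {y Ψ : ℕ → ℝ → ℝ → ℝ} (hc : ∀ i ∈ s, 0 ≤ c i)
    (hoff : ∀ i ∈ s, ∀ j ∈ s, i ≠ j → ∀ x ∈ Set.Icc (0:ℝ) 1, ∀ t ∈ Set.Icc (0:ℝ) T,
      a i j x t ≤ 0)
    (hrow : ∀ i ∈ s, ∀ x ∈ Set.Icc (0:ℝ) 1, ∀ t ∈ Set.Icc (0:ℝ) T, 0 < ∑ j ∈ s, a i j x t)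
    (hy : ∀ i ∈ s, Smooth₂ (y i)) (hΨ : ∀ i ∈ s, Smooth₂ (Ψ i))
    (hbot : ∀ i ∈ s, ∀ x ∈ Set.Icc (0:ℝ) 1, |y i x 0| ≤ Ψ i x 0)
    (hside : ∀ i ∈ s, ∀ t ∈ Set.Icc (0:ℝ) T,
      c i = 0 ∨ (|y i 0 t| ≤ Ψ i 0 t ∧ |y i 1 t| ≤ Ψ i 1 t))
    (hL : ∀ i ∈ s, ∀ x ∈ Set.Icc (0:ℝ) 1, ∀ t ∈ Set.Icc (0:ℝ) T,
      |parabolicOp s c a y i x t| ≤ parabolicOp s c a Ψ i x t) :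
    ∀ i ∈ s, ∀ x ∈ Set.Icc (0:ℝ) 1, ∀ t ∈ Set.Icc (0:ℝ) T, |y i x t| ≤ Ψ i x t := by
  have hupper := nonneg_of_parabolicOp_nonneg (ψ := fun j x t => Ψ j x t - y j x t) hc hoff hrow
    (fun i hi => (hΨ i hi).sub (hy i hi))
    (fun i hi x hx => sub_nonneg.2 ((le_abs_self _).trans (hbot i hi x hx)))
    (fun i hi t ht => (hside i hi t ht).imp_right fun h =>
      ⟨sub_nonneg.2 ((le_abs_self _).trans h.1), sub_nonneg.2 ((le_abs_self _).trans h.2)⟩)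
    (fun i hi x hx t ht => by
      rw [parabolicOp_sub c a (hΨ i hi) (hy i hi)]
      exact sub_nonneg.2 ((le_abs_self _).trans (hL i hi x hx t ht)))
  have hlower := nonneg_of_parabolicOp_nonneg (ψ := fun j x t => Ψ j x t - -y j x t) hc hoff hrow
    (fun i hi => (hΨ i hi).sub (hy i hi).neg)
    (fun i hi x hx => sub_nonneg.2 ((neg_le_abs _).trans (hbot i hi x hx)))
    (fun i hi t ht => (hside i hi t ht).imp_right fun h =>
      ⟨sub_nonneg.2 ((neg_le_abs _).trans h.1), sub_nonneg.2 ((neg_le_abs _).trans h.2)⟩)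
    (fun i hi x hx t ht => by
      rw [parabolicOp_sub (χ := fun j x t => -y j x t) c a (hΨ i hi) (hy i hi).neg,
        parabolicOp_neg]
      exact sub_nonneg.2 ((neg_le_abs _).trans (hL i hi x hx t ht)))
  intro i hi x hx t ht
  have h₁ := hupper i hi x hx t ht
  have h₂ := hlower i hi x hx t ht
  exact abs_le.2 ⟨by linarith, by linarith⟩

theorem parabolicOp_of_indep {s : Finset ℕ} (c : ℕ → ℝ) (a : ℕ → ℕ → ℝ → ℝ → ℝ)
    (g : ℕ → ℝ → ℝ) (i : ℕ) (x t : ℝ) :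
    parabolicOp s c a (fun j y _ => g j y) i x t =
      -(c i * deriv (deriv (g i)) x) + ∑ j ∈ s, a i j x t * g j x := by
  have h₁ : dt (fun y _ => g i y) x t = 0 := deriv_const t (g i x)
  have h₂ : dx (dx (fun y _ => g i y)) x t = deriv (deriv (g i)) x := rfl
  simp only [parabolicOp, h₁, h₂]
  ring

/-- Maximum-norm stability of the operator. -/
theorem abs_le_of_abs_parabolicOp_le_const {s : Finset ℕ} {T α K : ℝ} {c : ℕ → ℝ}
    {a : ℕ → ℕ → ℝ → ℝ → ℝ} {y : ℕ → ℝ → ℝ → ℝ} (hα : 0 < α) (hc : ∀ i ∈ s, 0 ≤ c i)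
    (hoff : ∀ i ∈ s, ∀ j ∈ s, i ≠ j → ∀ x ∈ Set.Icc (0:ℝ) 1, ∀ t ∈ Set.Icc (0:ℝ) T,
      a i j x t ≤ 0)
    (hrow : ∀ i ∈ s, ∀ x ∈ Set.Icc (0:ℝ) 1, ∀ t ∈ Set.Icc (0:ℝ) T, α < ∑ j ∈ s, a i j x t)
    (hy : ∀ i ∈ s, Smooth₂ (y i)) (hK : 0 ≤ K)
    (hbot : ∀ i ∈ s, ∀ x ∈ Set.Icc (0:ℝ) 1, |y i x 0| ≤ K)
    (hside : ∀ i ∈ s, ∀ t ∈ Set.Icc (0:ℝ) T, c i = 0 ∨ (|y i 0 t| ≤ K ∧ |y i 1 t| ≤ K))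
    (hL : ∀ i ∈ s, ∀ x ∈ Set.Icc (0:ℝ) 1, ∀ t ∈ Set.Icc (0:ℝ) T,
      |parabolicOp s c a y i x t| ≤ α * K) :
    ∀ i ∈ s, ∀ x ∈ Set.Icc (0:ℝ) 1, ∀ t ∈ Set.Icc (0:ℝ) T, |y i x t| ≤ K := by
  refine abs_le_of_abs_parabolicOp_le (Ψ := fun _ _ _ => K) hc hoff
    (fun i hi x hx t ht => hα.trans (hrow i hi x hx t ht)) hy (fun _ _ => Smooth₂.const K)
    hbot hside fun i hi x hx t ht => (hL i hi x hx t ht).trans ?_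
  rw [parabolicOp_of_indep c a (fun _ _ => K)]
  simp only [deriv_const', ← Finset.sum_mul, mul_zero, neg_zero, zero_add]
  exact mul_le_mul_of_nonneg_right (hrow i hi x hx t ht).le hK

theorem Smooth₂.parabolicOp {s : Finset ℕ} (c : ℕ → ℝ) {a : ℕ → ℕ → ℝ → ℝ → ℝ}
    {ψ : ℕ → ℝ → ℝ → ℝ} {i : ℕ} (hi : i ∈ s) (ha : ∀ j ∈ s, Smooth₂ (a i j))
    (hψ : ∀ j ∈ s, Smooth₂ (ψ j)) : Smooth₂ (parabolicOp s c a ψ i) :=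
  ((hψ i hi).dt.sub ((Smooth₂.const (c i)).mul (hψ i hi).dx.dx)).add
    (Smooth₂.sum fun j hj => (ha j hj).mul (hψ j hj))

theorem dx_parabolicOp {s : Finset ℕ} (c : ℕ → ℝ) {a : ℕ → ℕ → ℝ → ℝ → ℝ}
    {ψ : ℕ → ℝ → ℝ → ℝ} {i : ℕ} (hi : i ∈ s) (ha : ∀ j ∈ s, Smooth₂ (a i j))
    (hψ : ∀ j ∈ s, Smooth₂ (ψ j)) (x t : ℝ) :
    dx (parabolicOp s c a ψ i) x t =
      parabolicOp s c a (fun j => dx (ψ j)) i x t + ∑ j ∈ s, dx (a i j) x t * ψ j x t := by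
  have hi' := hψ i hi
  have h₁ : dx (parabolicOp s c a ψ i) = fun x t =>
      (dx (dt (ψ i)) x t - c i * dx (dx (dx (ψ i))) x t) +
        ∑ j ∈ s, dx (fun x t => a i j x t * ψ j x t) x t := by
    refine ((hi'.dt.sub ((Smooth₂.const (c i)).mul hi'.dx.dx)).dx_add
      (Smooth₂.sum fun j hj => (ha j hj).mul (hψ j hj))).trans ?_
    rw [hi'.dt.dx_sub ((Smooth₂.const (c i)).mul hi'.dx.dx), hi'.dx.dx.dx_const_mul,
      Smooth₂.dx_sum fun j hj => (ha j hj).mul (hψ j hj)]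
  have h₂ : ∑ j ∈ s, dx (fun x t => a i j x t * ψ j x t) x t =
      ∑ j ∈ s, (dx (a i j) x t * ψ j x t + a i j x t * dx (ψ j) x t) :=
    Finset.sum_congr rfl fun j hj => by rw [(ha j hj).dx_mul (hψ j hj)]
  rw [h₁, parabolicOp]
  simp only [h₂, Finset.sum_add_distrib, hi'.dx_dt_comm]
  ring

/-- Differentiating the equation in `x` on the closed rectangle. -/
theorem parabolicOp_dx_eq {s : Finset ℕ} {T : ℝ} (c : ℕ → ℝ) {a : ℕ → ℕ → ℝ → ℝ → ℝ}
    {ψ : ℕ → ℝ → ℝ → ℝ} {i : ℕ} {k : ℝ → ℝ → ℝ} (hi : i ∈ s) (ha : ∀ j ∈ s, Smooth₂ (a i j))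
    (hψ : ∀ j ∈ s, Smooth₂ (ψ j)) (hk : Smooth₂ k)
    (h : ∀ x ∈ Set.Icc (0:ℝ) 1, ∀ t ∈ Set.Icc (0:ℝ) T, parabolicOp s c a ψ i x t = k x t) :
    ∀ x ∈ Set.Icc (0:ℝ) 1, ∀ t ∈ Set.Icc (0:ℝ) T,
      parabolicOp s c a (fun j => dx (ψ j)) i x t =
        dx k x t - ∑ j ∈ s, dx (a i j) x t * ψ j x t := by
  intro x hx t ht
  have h₁ : dx (parabolicOp s c a ψ i) x t = dx k x t :=
    deriv_eq_of_eqOn_Icc one_pos ((Smooth₂.parabolicOp c hi ha hψ).differentiable_left t)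
      (hk.differentiable_left t) (fun y hy => h y hy t ht) hx
  rw [← h₁, dx_parabolicOp c hi ha hψ]
  ring

/-- Interpolation: a first derivative is controlled by the function and its second derivative. -/
theorem abs_deriv_le_interpolation {g : ℝ → ℝ} (hg : Differentiable ℝ g)
    (hg' : Differentiable ℝ (deriv g)) {V N δ : ℝ} (hδ : 0 < δ) (hδ1 : δ ≤ 1)
    (hV : ∀ x ∈ Set.Icc (0:ℝ) 1, |g x| ≤ V)
    (hN : ∀ x ∈ Set.Icc (0:ℝ) 1, |deriv (deriv g) x| ≤ N) :
    ∀ x ∈ Set.Icc (0:ℝ) 1, |deriv g x| ≤ 2 * V / δ + N * δ := by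
  intro x hx
  obtain ⟨b, hb0, hb1, hbx, hxb⟩ : ∃ b, 0 ≤ b ∧ b + δ ≤ 1 ∧ b ≤ x ∧ x ≤ b + δ := by
    rcases le_total (x + δ) 1 with h | h
    · exact ⟨x, hx.1, h, le_rfl, by linarith⟩
    · exact ⟨1 - δ, by linarith, by linarith, by linarith, by linarith [hx.2]⟩
  obtain ⟨ξ, hξ, hξd⟩ := exists_deriv_eq_slope g (by linarith : b < b + δ)
    hg.continuous.continuousOn hg.differentiableOn
  have h₁ : |deriv g ξ| ≤ 2 * V / δ := by
    rw [hξd, abs_div, add_sub_cancel_left, abs_of_pos hδ]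
    gcongr
    have := hV (b + δ) ⟨by linarith, hb1⟩
    have := hV b ⟨hb0, by linarith⟩
    rw [abs_le] at *
    constructor <;> linarith
  have hsub : ∀ z ∈ Set.Icc b (b + δ), z ∈ Set.Icc (0:ℝ) 1 :=
    fun z hz => ⟨by linarith [hz.1], by linarith [hz.2]⟩
  have h₂ : |deriv g x - deriv g ξ| ≤ N * |x - ξ| :=
    (convex_Icc b (b + δ)).norm_image_sub_le_of_norm_deriv_le (fun z _ => hg' z)
      (fun z hz => hN z (hsub z hz)) ⟨hξ.1.le, hξ.2.le⟩ ⟨hbx, hxb⟩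
  have hN0 : 0 ≤ N := (abs_nonneg _).trans (hN x hx)
  have h₃ : |x - ξ| ≤ δ := by
    rw [abs_le]; constructor <;> linarith [hξ.1, hξ.2]
  have h₄ : |deriv g x| ≤ |deriv g ξ| + |deriv g x - deriv g ξ| := by
    simpa using abs_add_le (deriv g ξ) (deriv g x - deriv g ξ)
  nlinarith

theorem abs_deriv_le_of_abs_le_mul_sub {g : ℝ → ℝ} {x₀ K : ℝ} (hx₀ : x₀ = 0 ∨ x₀ = 1)
    (hg : DifferentiableAt ℝ g x₀) (h0 : g x₀ = 0)
    (h : ∀ x ∈ Set.Icc (0:ℝ) 1, |g x| ≤ K * |x - x₀|) : |deriv g x₀| ≤ K := by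
  have hx : x₀ ∈ Set.Icc (0:ℝ) 1 := by rcases hx₀ with rfl | rfl <;> simp
  have hacc : (nhdsWithin x₀ (Set.Icc (0:ℝ) 1 \ {x₀})).NeBot :=
    accPt_principal_iff_nhdsWithin.1 ((uniqueDiffOn_Icc one_pos).uniqueDiffWithinAt hx).accPt
  have hlim : Filter.Tendsto (slope g x₀) (nhdsWithin x₀ (Set.Icc (0:ℝ) 1 \ {x₀}))
      (nhds (deriv g x₀)) :=
    (hasDerivAt_iff_tendsto_slope.1 hg.hasDerivAt).mono_left
      (nhdsWithin_mono _ fun y hy => hy.2)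
  refine le_of_tendsto hlim.abs ?_
  filter_upwards [self_mem_nhdsWithin] with y hy
  have hpos : 0 < |y - x₀| := abs_pos.2 (sub_ne_zero.2 hy.2)
  rw [slope_def_field, h0, sub_zero, abs_div, div_le_iff₀ hpos]
  exact h y hy.1

theorem deriv_deriv_exp_barrier (M r x₀ x : ℝ) :
    deriv (deriv (fun y => M * (1 - Real.exp (r * (y - x₀))))) x =
      -(M * (r ^ 2 * Real.exp (r * (x - x₀)))) := by
  have hexp : ∀ y, HasDerivAt (fun y => Real.exp (r * (y - x₀)))
      (r * Real.exp (r * (y - x₀))) y := fun y => by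
    simpa [mul_comm] using (((hasDerivAt_id y).sub_const x₀).const_mul r).exp
  have h₁ : deriv (fun y => M * (1 - Real.exp (r * (y - x₀)))) =
      fun y => M * (-(r * Real.exp (r * (y - x₀)))) :=
    funext fun y => (((hexp y).const_sub 1).const_mul M).deriv
  rw [h₁, (((hexp x).const_mul r).fun_neg.const_mul M).deriv]
  ring

/-- Bound of the normal derivative on a side where the function vanishes. -/
theorem abs_dx_le_of_side_zero {T α P M ε x₀ : ℝ} {a Z : ℝ → ℝ → ℝ} (hα : 0 < α) (hε : 0 < ε)
    (hε1 : ε ≤ 1) (hP : 0 ≤ P) (hx₀ : x₀ = 0 ∨ x₀ = 1)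
    (ha : ∀ x ∈ Set.Icc (0:ℝ) 1, ∀ t ∈ Set.Icc (0:ℝ) T, α ≤ a x t) (hZ : Smooth₂ Z)
    (hbot : ∀ x ∈ Set.Icc (0:ℝ) 1, |Z x 0| ≤ P * |x - x₀|)
    (hside : ∀ t ∈ Set.Icc (0:ℝ) T, Z 0 t = 0 ∧ Z 1 t = 0)
    (hL : ∀ x ∈ Set.Icc (0:ℝ) 1, ∀ t ∈ Set.Icc (0:ℝ) T,
      |dt Z x t - ε * dx (dx Z) x t + a x t * Z x t| ≤ α * M)
    (hM : P * (1 + 1 / √α) ≤ M) :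
    ∀ t ∈ Set.Icc (0:ℝ) T, |dx Z x₀ t| ≤ M * √(α / ε) := by
  set s := √(α / ε) with hs
  have hspos : 0 < s := Real.sqrt_pos.2 (by positivity)
  have hs2 : ε * s ^ 2 = α := by
    rw [hs, Real.sq_sqrt (by positivity)]; field_simp
  have hαs : √α ≤ s := Real.sqrt_le_sqrt (by rw [le_div_iff₀ hε]; nlinarith)
  have hsα : 0 < √α := Real.sqrt_pos.2 hα
  have hM0 : 0 ≤ M := le_trans (by positivity) hM
  set r := -(s * (1 - 2 * x₀)) with hr
  have hr2 : r ^ 2 = s ^ 2 := by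
    rcases hx₀ with h | h <;> rw [hr, h] <;> ring
  have hrx : ∀ x ∈ Set.Icc (0:ℝ) 1, r * (x - x₀) = -(s * |x - x₀|) := by
    intro x hx
    rcases hx₀ with h | h
    · rw [hr, h, sub_zero, abs_of_nonneg hx.1]; ring
    · rw [hr, h, abs_of_nonpos (by linarith [hx.2])]; ring
  set E : ℝ → ℝ := fun x => Real.exp (r * (x - x₀)) with hE
  have hE0 : ∀ x, 0 < E x := fun x => Real.exp_pos _
  have hE1 : ∀ x ∈ Set.Icc (0:ℝ) 1, E x ≤ 1 := fun x hx => by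
    rw [hE, Real.exp_le_one_iff, hrx x hx]
    have := mul_nonneg hspos.le (abs_nonneg (x - x₀))
    linarith
  have hlower : ∀ x ∈ Set.Icc (0:ℝ) 1, P * |x - x₀| ≤ M * (1 - E x) := by
    intro x hx
    set d := |x - x₀| with hd
    have hd0 : 0 ≤ d := abs_nonneg _
    have hd1 : d ≤ 1 := by
      rw [hd, abs_le]
      rcases hx₀ with h | h <;> rw [h] <;> constructor <;> linarith [hx.1, hx.2]
    have h₁ : E x * (1 + s * d) ≤ 1 := by
      have h := Real.add_one_le_exp (s * d)
      have h' : E x * Real.exp (s * d) = 1 := by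
        simp only [hE]
        rw [← Real.exp_add, hrx x hx, neg_add_cancel, Real.exp_zero]
      nlinarith [hE0 x]
    have h₂ : s * d ≤ (1 + s) * (1 - E x) := by
      nlinarith [hE1 x hx, hE0 x, mul_nonneg hspos.le (sub_nonneg.2 (hE1 x hx)),
        mul_nonneg (mul_nonneg hspos.le (sub_nonneg.2 hd1)) (sub_nonneg.2 (hE1 x hx))]
    have h₃ : P * (1 + s) ≤ M * s := by
      have h4 : 1 / s ≤ 1 / √α := one_div_le_one_div_of_le hsα hαs
      have h5 : P * (1 + 1 / s) ≤ M := (mul_le_mul_of_nonneg_left (by linarith) hP).trans hM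
      calc P * (1 + s) = P * (1 + 1 / s) * s := by field_simp; ring
        _ ≤ M * s := mul_le_mul_of_nonneg_right h5 hspos.le
    have h₄ : s * (P * d) ≤ s * (M * (1 - E x)) := by
      calc s * (P * d) = P * (s * d) := by ring
        _ ≤ P * ((1 + s) * (1 - E x)) := mul_le_mul_of_nonneg_left h₂ hP
        _ = (P * (1 + s)) * (1 - E x) := by ring
        _ ≤ (M * s) * (1 - E x) :=
          mul_le_mul_of_nonneg_right h₃ (sub_nonneg.2 (hE1 x hx))
        _ = s * (M * (1 - E x)) := by ring
    exact le_of_mul_le_mul_left h₄ hspos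
  have hΨ0 : ∀ x ∈ Set.Icc (0:ℝ) 1, 0 ≤ M * (1 - E x) :=
    fun x hx => mul_nonneg hM0 (sub_nonneg.2 (hE1 x hx))
  have hcomp := abs_le_of_abs_parabolicOp_le (s := {0}) (T := T) (c := fun _ => ε)
    (a := fun _ _ => a) (y := fun _ => Z) (Ψ := fun _ x _ => M * (1 - E x))
    (fun _ _ => hε.le)
    (fun i hi j hj hij => absurd ((Finset.mem_singleton.1 hi).trans
      (Finset.mem_singleton.1 hj).symm) hij)
    (fun i _ x hx t ht => by simpa using hα.trans_le (ha x hx t ht))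
    (fun _ _ => hZ) (fun _ _ => by unfold Smooth₂; fun_prop)
    (fun _ _ x hx => (hbot x hx).trans (hlower x hx))
    (fun _ _ t ht => Or.inr ⟨by
      rw [(hside t ht).1, abs_zero]; exact hΨ0 0 (by simp), by
      rw [(hside t ht).2, abs_zero]; exact hΨ0 1 (by simp)⟩)
    (fun i _ x hx t ht => by
      rw [parabolicOp_of_indep (fun _ => ε) (fun _ _ => a) (fun _ x => M * (1 - E x)),
        deriv_deriv_exp_barrier, hr2]
      have h := hL x hx t ht
      simp only [parabolicOp, Finset.sum_singleton]
      refine h.trans ?_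
      change α * M ≤ -(ε * -(M * (s ^ 2 * E x))) + a x t * (M * (1 - E x))
      have h' : -(ε * -(M * (s ^ 2 * E x))) = (ε * s ^ 2) * (M * E x) := by ring
      rw [h', hs2]
      nlinarith [mul_le_mul_of_nonneg_right (ha x hx t ht) (hΨ0 x hx)])
    0 (by simp)
  intro t ht
  refine abs_deriv_le_of_abs_le_mul_sub hx₀ (hZ.differentiable_left t x₀) ?_ fun x hx => ?_
  · rcases hx₀ with h | h <;> rw [h]
    exacts [(hside t ht).1, (hside t ht).2]
  · refine (hcomp x hx t ht).trans ?_
    rw [mul_assoc]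
    refine mul_le_mul_of_nonneg_left ?_ hM0
    have := Real.add_one_le_exp (r * (x - x₀))
    rw [hrx x hx] at this
    change 1 - Real.exp (r * (x - x₀)) ≤ _
    rw [hrx x hx]
    linarith

/-- The sum of the left and right layer functions of decay rate `s`. -/
noncomputable def layerFn (s x : ℝ) : ℝ := Real.exp (-x * s) + Real.exp (-(1 - x) * s)

theorem layerFn_pos (s x : ℝ) : 0 < layerFn s x := by unfold layerFn; positivity

theorem layerFn_anti {s s' x : ℝ} (hx : x ∈ Set.Icc (0:ℝ) 1) (h : s ≤ s') :
    layerFn s' x ≤ layerFn s x := by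
  unfold layerFn
  refine add_le_add (Real.exp_le_exp.2 ?_) (Real.exp_le_exp.2 ?_)
  · nlinarith [hx.1]
  · nlinarith [hx.2]

theorem one_le_layerFn {s x : ℝ} (hx : x = 0 ∨ x = 1) : 1 ≤ layerFn s x := by
  rcases hx with rfl | rfl <;> simp [layerFn, Real.exp_nonneg]

theorem contDiff_layerFn (s : ℝ) : ContDiff ℝ (⊤ : ℕ∞) (layerFn s) := by
  unfold layerFn; fun_prop

theorem deriv_deriv_layerFn (s x : ℝ) :
    deriv (deriv (layerFn s)) x = s ^ 2 * layerFn s x := by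
  have h₁ : ∀ y, HasDerivAt (fun y => Real.exp (-y * s)) (-s * Real.exp (-y * s)) y := fun y => by
    simpa [mul_comm] using (((hasDerivAt_id y).neg).mul_const s).exp
  have h₂ : ∀ y, HasDerivAt (fun y => Real.exp (-(1 - y) * s))
      (s * Real.exp (-(1 - y) * s)) y := fun y => by
    simpa [mul_comm] using ((((hasDerivAt_id y).const_sub 1).neg).mul_const s).exp
  have h : deriv (layerFn s) = fun y =>
      -s * Real.exp (-y * s) + s * Real.exp (-(1 - y) * s) :=
    funext fun y => ((h₁ y).add (h₂ y)).deriv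
  rw [h, (((h₁ x).const_mul (-s)).fun_add ((h₂ x).const_mul s)).deriv, layerFn]
  ring

theorem deriv_deriv_one_add_sum_layerFn (S : Finset ℕ) (w s : ℕ → ℝ) (x : ℝ) :
    deriv (deriv (fun y => 1 + ∑ q ∈ S, w q * layerFn (s q) y)) x =
      ∑ q ∈ S, w q * ((s q) ^ 2 * layerFn (s q) x) := by
  have h₁ : ∀ q y, HasDerivAt (layerFn (s q)) (deriv (layerFn (s q)) y) y := fun q y =>
    ((contDiff_layerFn (s q)).differentiable (by simp) y).hasDerivAt
  have h₂ : ∀ q, HasDerivAt (deriv (layerFn (s q))) (s q ^ 2 * layerFn (s q) x) x := fun q => by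
    rw [← deriv_deriv_layerFn]
    exact (((contDiff_infty_iff_deriv.1 (contDiff_layerFn (s q))).2).differentiable
      (by simp) x).hasDerivAt
  have h : deriv (fun y => 1 + ∑ q ∈ S, w q * layerFn (s q) y) =
      fun y => ∑ q ∈ S, w q * deriv (layerFn (s q)) y :=
    funext fun y =>
      ((HasDerivAt.fun_sum fun q _ => (h₁ q y).const_mul (w q)).const_add 1).deriv
  rw [h]
  exact (HasDerivAt.fun_sum fun q _ => (h₂ q).const_mul (w q)).deriv

open Classical in
/-- Indices after which the decay rates `s` drop by a factor at least `R`. -/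
noncomputable def gapIndices (n : ℕ) (R : ℝ) (s : ℕ → ℝ) : Finset ℕ :=
  (Finset.Icc 1 n).filter fun q => ∀ j ∈ Finset.Icc 1 n, q < j → R * s j ≤ s q

theorem mem_gapIndices {n : ℕ} {R : ℝ} {s : ℕ → ℝ} {q : ℕ} : q ∈ gapIndices n R s ↔
    q ∈ Finset.Icc 1 n ∧ ∀ j ∈ Finset.Icc 1 n, q < j → R * s j ≤ s q := by
  simp [gapIndices]

theorem exists_gapIndex_ge {n : ℕ} {R : ℝ} {s : ℕ → ℝ} (hR : 1 ≤ R)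
    (hs : ∀ i ∈ Finset.Icc 1 n, 0 < s i) {i : ℕ} (hi : i ∈ Finset.Icc 1 n) :
    ∃ q ∈ gapIndices n R s, i ≤ q ∧ s i ≤ R ^ n * s q := by
  suffices h : ∀ m i, i ∈ Finset.Icc 1 n → n - i = m →
      ∃ q ∈ gapIndices n R s, i ≤ q ∧ s i ≤ R ^ m * s q by
    obtain ⟨q, hq, hiq, h'⟩ := h _ i hi rfl
    have hqn := (mem_gapIndices.1 hq).1
    exact ⟨q, hq, hiq, h'.trans (mul_le_mul_of_nonneg_right
      (pow_le_pow_right₀ hR (Nat.sub_le n i)) (hs q hqn).le)⟩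
  intro m
  induction m using Nat.strong_induction_on with
  | _ m ih =>
    intro i hi hm
    by_cases hgap : ∀ j ∈ Finset.Icc 1 n, i < j → R * s j ≤ s i
    · exact ⟨i, mem_gapIndices.2 ⟨hi, hgap⟩, le_rfl,
        le_mul_of_one_le_left (hs i hi).le (one_le_pow₀ hR)⟩
    · push Not at hgap
      obtain ⟨j, hj, hij, hlt⟩ := hgap
      rw [Finset.mem_Icc] at hj hi
      obtain ⟨q, hq, hjq, h⟩ := ih (n - j) (by omega) j (Finset.mem_Icc.2 hj) rfl
      refine ⟨q, hq, by omega, hlt.le.trans ?_⟩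
      have hqpos := hs q (mem_gapIndices.1 hq).1
      calc R * s j ≤ R * (R ^ (n - j) * s q) := mul_le_mul_of_nonneg_left h (by linarith)
        _ = R ^ (n - j + 1) * s q := by ring
        _ ≤ R ^ m * s q :=
          mul_le_mul_of_nonneg_right (pow_le_pow_right₀ hR (by omega)) hqpos.le

/-- Amplitude of the layer of rate `s q` in the `i`-th component of the layer barrier. -/
noncomputable def layerWeight (R : ℝ) (s : ℕ → ℝ) (i q : ℕ) : ℝ :=
  if i ≤ q then s q else -(R ^ 2 * s i ^ 2 / s q)

theorem abs_layerWeight_le {n : ℕ} {R : ℝ} {s : ℕ → ℝ} (hR : 1 ≤ R)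
    (hs : ∀ i ∈ Finset.Icc 1 n, 0 < s i) {i q : ℕ} (hi : i ∈ Finset.Icc 1 n)
    (hq : q ∈ gapIndices n R s) : |layerWeight R s i q| ≤ s q := by
  obtain ⟨hqn, hgap⟩ := mem_gapIndices.1 hq
  have hqpos := hs q hqn
  unfold layerWeight
  split_ifs with h
  · rw [abs_of_pos hqpos]
  · have h₁ := hgap i hi (not_le.1 h)
    have h₂ : 0 < R * s i := mul_pos (by linarith) (hs i hi)
    rw [abs_neg, abs_of_nonneg (by positivity), div_le_iff₀ hqpos]
    nlinarith

/-- Each layer of the barrier is a supersolution. -/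
theorem layerWeight_supersolution {n : ℕ} {R α D : ℝ} {s ε : ℕ → ℝ} (hR : 1 ≤ R) (hα : 0 < α)
    (hs : ∀ i ∈ Finset.Icc 1 n, 0 < s i)
    (hmono : ∀ i ∈ Finset.Icc 1 n, ∀ j ∈ Finset.Icc 1 n, i ≤ j → ε i ≤ ε j)
    (hsε : ∀ i ∈ Finset.Icc 1 n, ε i * s i ^ 2 = α) (hD : n * D ≤ R * α)
    {b : ℕ → ℝ} {i q : ℕ} (hi : i ∈ Finset.Icc 1 n) (hq : q ∈ gapIndices n R s)
    (hoff : ∀ j ∈ Finset.Icc 1 n, i ≠ j → b j ≤ 0)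
    (hrow : α < ∑ j ∈ Finset.Icc 1 n, b j) (hb : ∀ j ∈ Finset.Icc 1 n, |b j| ≤ D) :
    0 ≤ -(ε i * (layerWeight R s i q * s q ^ 2)) +
      ∑ j ∈ Finset.Icc 1 n, b j * layerWeight R s j q := by
  have hqn := (mem_gapIndices.1 hq).1
  have hqpos := hs q hqn
  by_cases hiq : i ≤ q
  · have hwi : layerWeight R s i q = s q := if_pos hiq
    have hsum : (∑ j ∈ Finset.Icc 1 n, b j) * s q ≤
        ∑ j ∈ Finset.Icc 1 n, b j * layerWeight R s j q := by
      rw [Finset.sum_mul]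
      refine Finset.sum_le_sum fun j hj => ?_
      by_cases hij : i = j
      · rw [← hij, hwi]
      · exact mul_le_mul_of_nonpos_left
          ((le_abs_self _).trans (abs_layerWeight_le hR hs hj hq)) (hoff j hj hij)
    have h₁ : ε i * s q ^ 2 ≤ α := by
      rw [← hsε q hqn]
      exact mul_le_mul_of_nonneg_right (hmono i hi q hqn hiq) (by positivity)
    have h₂ : ε i * s q ^ 2 * s q ≤ α * s q := mul_le_mul_of_nonneg_right h₁ hqpos.le
    have h₃ := mul_lt_mul_of_pos_right hrow hqpos
    rw [hwi]
    linarith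
  · have hwi : layerWeight R s i q = -(R ^ 2 * s i ^ 2 / s q) := if_neg hiq
    have hsum : -(n * D * s q) ≤ ∑ j ∈ Finset.Icc 1 n, b j * layerWeight R s j q := by
      have h : ∀ j ∈ Finset.Icc 1 n, -(D * s q) ≤ b j * layerWeight R s j q := by
        intro j hj
        refine neg_le_of_abs_le ?_
        rw [abs_mul]
        exact mul_le_mul (hb j hj) (abs_layerWeight_le hR hs hj hq) (abs_nonneg _)
          ((abs_nonneg _).trans (hb j hj))
      have := Finset.sum_le_sum h
      simp only [Finset.sum_const, Nat.card_Icc, add_tsub_cancel_right, nsmul_eq_mul] at this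
      linarith
    have h₁ : -(ε i * (layerWeight R s i q * s q ^ 2)) = R ^ 2 * α * s q := by
      rw [hwi, ← hsε i hi]; field_simp
    rw [h₁]
    have h₂ : n * D * s q ≤ R * α * s q := mul_le_mul_of_nonneg_right hD hqpos.le
    have h₃ : R * α * s q ≤ R ^ 2 * α * s q := by
      refine mul_le_mul_of_nonneg_right (mul_le_mul_of_nonneg_right ?_ hα.le) hqpos.le
      nlinarith
    linarith

/-- The base of the geometric weights of the layer barrier. -/
noncomputable def layerBase (n : ℕ) (R : ℝ) : ℝ := R ^ n * (1 + n * R ^ 2)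

theorem one_le_layerBase (n : ℕ) {R : ℝ} (hR : 1 ≤ R) : 1 ≤ layerBase n R := by
  have : 1 ≤ R ^ n := one_le_pow₀ hR
  have h2 : 0 ≤ (n : ℝ) * R ^ 2 := by positivity
  unfold layerBase
  nlinarith

/-- A barrier growing like the layers with index at least that of the component. -/
noncomputable def layerBarrier (n : ℕ) (R : ℝ) (s : ℕ → ℝ) (i : ℕ) (x : ℝ) : ℝ :=
  1 + ∑ q ∈ gapIndices n R s, layerBase n R ^ q * layerWeight R s i q * layerFn (s q) x

theorem contDiff_layerBarrier (n : ℕ) (R : ℝ) (s : ℕ → ℝ) (i : ℕ) :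
    ContDiff ℝ (⊤ : ℕ∞) (layerBarrier n R s i) :=
  contDiff_const.add (ContDiff.sum fun q _ => contDiff_const.mul (contDiff_layerFn (s q)))

theorem layerBarrier_le {n : ℕ} {R : ℝ} {s : ℕ → ℝ} (hR : 1 ≤ R)
    (hs : ∀ i ∈ Finset.Icc 1 n, 0 < s i) {i : ℕ} (hi : i ∈ Finset.Icc 1 n) (x : ℝ) :
    layerBarrier n R s i x ≤
      layerBase n R ^ n * (1 + ∑ q ∈ Finset.Icc i n, s q * layerFn (s q) x) := by
  have hΛ := one_le_layerBase n hR
  have hΛn : 1 ≤ layerBase n R ^ n := one_le_pow₀ hΛ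
  rw [Finset.mem_Icc] at hi
  have hsum : ∑ q ∈ gapIndices n R s, layerBase n R ^ q * layerWeight R s i q * layerFn (s q) x ≤
      ∑ q ∈ Finset.Icc i n, layerBase n R ^ n * (s q * layerFn (s q) x) := by
    have h₁ : ∀ q ∈ gapIndices n R s,
        layerBase n R ^ q * layerWeight R s i q * layerFn (s q) x ≤
          if i ≤ q then layerBase n R ^ n * (s q * layerFn (s q) x) else 0 := by
      intro q hq
      have hqn := (mem_gapIndices.1 hq).1
      have hqpos := hs q hqn
      have hB := layerFn_pos (s q) x
      unfold layerWeight
      split_ifs with h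
      · rw [mul_assoc]
        exact mul_le_mul_of_nonneg_right
          (pow_le_pow_right₀ hΛ (Finset.mem_Icc.1 hqn).2) (by positivity)
      · have h₂ : 0 ≤ layerBase n R ^ q := by positivity
        have h₃ : 0 ≤ R ^ 2 * s i ^ 2 / s q := by positivity
        nlinarith [mul_nonneg (mul_nonneg h₂ h₃) hB.le]
    refine (Finset.sum_le_sum h₁).trans ?_
    rw [← Finset.sum_filter]
    refine Finset.sum_le_sum_of_subset_of_nonneg ?_ ?_
    · intro q hq
      obtain ⟨hq, hiq⟩ := Finset.mem_filter.1 hq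
      exact Finset.mem_Icc.2 ⟨hiq, (Finset.mem_Icc.1 (mem_gapIndices.1 hq).1).2⟩
    · intro q hq _
      rw [Finset.mem_Icc] at hq
      have := hs q (Finset.mem_Icc.2 ⟨by omega, hq.2⟩)
      have hB := layerFn_pos (s q) x
      positivity
  rw [mul_add, mul_one, Finset.mul_sum]
  exact add_le_add hΛn hsum

theorem le_layerBarrier {n : ℕ} {R : ℝ} {s : ℕ → ℝ} (hR : 1 ≤ R)
    (hs : ∀ i ∈ Finset.Icc 1 n, 0 < s i)
    (hanti : ∀ i ∈ Finset.Icc 1 n, ∀ j ∈ Finset.Icc 1 n, i ≤ j → s j ≤ s i)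
    {i : ℕ} (hi : i ∈ Finset.Icc 1 n) {x : ℝ} (hx : x ∈ Set.Icc (0:ℝ) 1) :
    1 + s i * layerFn (s i) x ≤ layerBarrier n R s i x := by
  obtain ⟨p, hp, hip, hsp⟩ := exists_gapIndex_ge hR hs hi
  have hpn := (mem_gapIndices.1 hp).1
  set Λ := layerBase n R with hΛdef
  have hΛ : 1 ≤ Λ := one_le_layerBase n hR
  have hspos := hs i hi
  have hB := layerFn_pos (s i) x
  set Y := s i * layerFn (s i) x with hY
  have hYpos : 0 < Y := mul_pos hspos hB
  have h1i : 1 ≤ i := (Finset.mem_Icc.1 hi).1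
  have hmain : (1 + n * R ^ 2) * Λ ^ (i - 1) * Y ≤
      Λ ^ p * layerWeight R s i p * layerFn (s p) x := by
    have hw : layerWeight R s i p = s p := if_pos hip
    rw [hw]
    have h₁ : Λ ^ i ≤ Λ ^ p := pow_le_pow_right₀ hΛ hip
    have h₂ : Λ ^ i = R ^ n * ((1 + n * R ^ 2) * Λ ^ (i - 1)) := by
      have hΛeq : Λ = R ^ n * (1 + n * R ^ 2) := rfl
      conv_lhs => rw [← Nat.sub_add_cancel h1i, pow_succ]
      nth_rewrite 2 [hΛeq]
      ring
    have h₃ : Y ≤ R ^ n * s p * layerFn (s p) x :=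
      mul_le_mul hsp (layerFn_anti hx (hanti i hi p hpn hip)) hB.le
        (by have := hs p hpn; positivity)
    have h₄ : 0 ≤ s p * layerFn (s p) x := (mul_pos (hs p hpn) (layerFn_pos _ _)).le
    calc (1 + n * R ^ 2) * Λ ^ (i - 1) * Y
        ≤ (1 + n * R ^ 2) * Λ ^ (i - 1) * (R ^ n * s p * layerFn (s p) x) :=
          mul_le_mul_of_nonneg_left h₃ (by positivity)
      _ = Λ ^ i * (s p * layerFn (s p) x) := by rw [h₂]; ring
      _ ≤ Λ ^ p * (s p * layerFn (s p) x) := mul_le_mul_of_nonneg_right h₁ h₄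
      _ = Λ ^ p * s p * layerFn (s p) x := by ring
  have hrest : -(n * (R ^ 2 * Λ ^ (i - 1) * Y)) ≤ ∑ q ∈ (gapIndices n R s).erase p,
      Λ ^ q * layerWeight R s i q * layerFn (s q) x := by
    have hterm : ∀ q ∈ (gapIndices n R s).erase p, -(R ^ 2 * Λ ^ (i - 1) * Y) ≤
        Λ ^ q * layerWeight R s i q * layerFn (s q) x := by
      intro q hq
      have hqn := (mem_gapIndices.1 (Finset.mem_of_mem_erase hq)).1
      have hqpos := hs q hqn
      have hBq := layerFn_pos (s q) x
      unfold layerWeight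
      split_ifs with h
      · have h₁ : 0 ≤ R ^ 2 * Λ ^ (i - 1) * Y := by positivity
        have h₂ : 0 ≤ Λ ^ q * s q * layerFn (s q) x := by positivity
        linarith
      · have hqi : q ≤ i := (not_le.1 h).le
        have h₁ : s i ^ 2 / s q ≤ s i := by
          rw [div_le_iff₀ hqpos]
          nlinarith [hanti q hqn i hi hqi]
        have h₂ : layerFn (s q) x ≤ layerFn (s i) x := layerFn_anti hx (hanti q hqn i hi hqi)
        have h₃ : Λ ^ q ≤ Λ ^ (i - 1) := pow_le_pow_right₀ hΛ (by omega)
        have h₄ : (s i ^ 2 / s q) * layerFn (s q) x ≤ Y := mul_le_mul h₁ h₂ hBq.le hspos.le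
        have h₅ : Λ ^ q * ((s i ^ 2 / s q) * layerFn (s q) x) ≤ Λ ^ (i - 1) * Y :=
          mul_le_mul h₃ h₄ (by positivity) (by positivity)
        have h₆ := mul_le_mul_of_nonneg_left h₅ (by positivity : 0 ≤ R ^ 2)
        have h₇ : Λ ^ q * -(R ^ 2 * s i ^ 2 / s q) * layerFn (s q) x =
            -(R ^ 2 * (Λ ^ q * ((s i ^ 2 / s q) * layerFn (s q) x))) := by ring
        rw [h₇]
        linarith
    have hcard : (((gapIndices n R s).erase p).card : ℝ) ≤ n := by
      have h₁ := Finset.card_erase_le (s := gapIndices n R s) (a := p)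
      have h₂ : (gapIndices n R s).card ≤ (Finset.Icc 1 n).card :=
        Finset.card_le_card fun q hq => (mem_gapIndices.1 hq).1
      rw [Nat.card_Icc, add_tsub_cancel_right] at h₂
      exact_mod_cast h₁.trans h₂
    have h := Finset.sum_le_sum hterm
    rw [Finset.sum_const, nsmul_eq_mul] at h
    have h' : 0 ≤ R ^ 2 * Λ ^ (i - 1) * Y := by positivity
    nlinarith [mul_le_mul_of_nonneg_right hcard h']
  have hΛi : 1 ≤ Λ ^ (i - 1) := one_le_pow₀ hΛ
  rw [layerBarrier, ← Finset.add_sum_erase _ _ hp, ← hΛdef]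
  nlinarith [mul_le_mul_of_nonneg_right hΛi hYpos.le]

theorem layerBarrier_supersolution {n : ℕ} {R α D : ℝ} {s ε : ℕ → ℝ} (hR : 1 ≤ R) (hα : 0 < α)
    (hs : ∀ i ∈ Finset.Icc 1 n, 0 < s i)
    (hmono : ∀ i ∈ Finset.Icc 1 n, ∀ j ∈ Finset.Icc 1 n, i ≤ j → ε i ≤ ε j)
    (hsε : ∀ i ∈ Finset.Icc 1 n, ε i * s i ^ 2 = α) (hD : n * D ≤ R * α)
    {b : ℕ → ℝ} {i : ℕ} (hi : i ∈ Finset.Icc 1 n)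
    (hoff : ∀ j ∈ Finset.Icc 1 n, i ≠ j → b j ≤ 0)
    (hrow : α < ∑ j ∈ Finset.Icc 1 n, b j) (hb : ∀ j ∈ Finset.Icc 1 n, |b j| ≤ D) (x : ℝ) :
    α ≤ -(ε i * deriv (deriv (layerBarrier n R s i)) x) +
      ∑ j ∈ Finset.Icc 1 n, b j * layerBarrier n R s j x := by
  have hΛ := one_le_layerBase n hR
  have hd : deriv (deriv (layerBarrier n R s i)) x = ∑ q ∈ gapIndices n R s,
      layerBase n R ^ q * layerWeight R s i q * (s q ^ 2 * layerFn (s q) x) :=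
    deriv_deriv_one_add_sum_layerFn _ _ _ _
  have hkey : -(ε i * deriv (deriv (layerBarrier n R s i)) x) +
      ∑ j ∈ Finset.Icc 1 n, b j * layerBarrier n R s j x =
      ∑ j ∈ Finset.Icc 1 n, b j + ∑ q ∈ gapIndices n R s,
        layerBase n R ^ q * layerFn (s q) x * (-(ε i * (layerWeight R s i q * s q ^ 2)) +
          ∑ j ∈ Finset.Icc 1 n, b j * layerWeight R s j q) := by
    rw [hd]
    simp only [layerBarrier, mul_add, mul_one, Finset.sum_add_distrib, Finset.mul_sum,
      ← Finset.sum_neg_distrib]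
    rw [Finset.sum_comm, add_left_comm]
    congr 2
    · exact Finset.sum_congr rfl fun q _ => by ring
    · exact Finset.sum_congr rfl fun q _ => Finset.sum_congr rfl fun j _ => by ring
  rw [hkey]
  have hnonneg : 0 ≤ ∑ q ∈ gapIndices n R s,
      layerBase n R ^ q * layerFn (s q) x * (-(ε i * (layerWeight R s i q * s q ^ 2)) +
        ∑ j ∈ Finset.Icc 1 n, b j * layerWeight R s j q) := by
    refine Finset.sum_nonneg fun q hq => mul_nonneg ?_
      (layerWeight_supersolution hR hα hs hmono hsε hD hi hq hoff hrow hb)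
    have := layerFn_pos (s q) x
    positivity
  linarith

theorem eq_on_closed_rectangle {F G : ℝ → ℝ → ℝ} {T : ℝ} (hT : 0 < T) (hF : Smooth₂ F)
    (hG : Smooth₂ G) (h : ∀ x t : ℝ, 0 < x → x < 1 → 0 < t → t ≤ T → F x t = G x t) :
    ∀ x ∈ Set.Icc (0:ℝ) 1, ∀ t ∈ Set.Icc (0:ℝ) T, F x t = G x t := by
  have hEq : Set.EqOn (fun p : ℝ × ℝ => F p.1 p.2) (fun p : ℝ × ℝ => G p.1 p.2)
      (Set.Ioo (0:ℝ) 1 ×ˢ Set.Ioo (0:ℝ) T) :=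
    fun p hp => h p.1 p.2 hp.1.1 hp.1.2 hp.2.1 hp.2.2.le
  have hcl := hEq.closure hF.continuous hG.continuous
  rw [closure_prod_eq, closure_Ioo zero_ne_one, closure_Ioo hT.ne] at hcl
  exact fun x hx t ht => hcl (Set.mk_mem_prod hx ht)

/-- The coupling term `Σ_j b_ij ψ_j`. -/
noncomputable def coupling (s : Finset ℕ) (b : ℕ → ℕ → ℝ → ℝ → ℝ) (ψ : ℕ → ℝ → ℝ → ℝ)
    (i : ℕ) (x t : ℝ) : ℝ := ∑ j ∈ s, b i j x t * ψ j x t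

section coupling

variable {s : Finset ℕ} {b : ℕ → ℕ → ℝ → ℝ → ℝ} {ψ : ℕ → ℝ → ℝ → ℝ} {i : ℕ}

theorem Smooth₂.coupling (hb : ∀ j ∈ s, Smooth₂ (b i j)) (hψ : ∀ j ∈ s, Smooth₂ (ψ j)) :
    Smooth₂ (coupling s b ψ i) :=
  Smooth₂.sum fun j hj => (hb j hj).mul (hψ j hj)

theorem dx_coupling (hb : ∀ j ∈ s, Smooth₂ (b i j)) (hψ : ∀ j ∈ s, Smooth₂ (ψ j)) (x t : ℝ) :
    dx (coupling s b ψ i) x t = coupling s (fun i j => dx (b i j)) ψ i x t +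
      coupling s b (fun j => dx (ψ j)) i x t := by
  have h : dx (coupling s b ψ i) x t = ∑ j ∈ s, dx (fun x t => b i j x t * ψ j x t) x t :=
    congrFun (congrFun (Smooth₂.dx_sum fun j hj => (hb j hj).mul (hψ j hj)) x) t
  rw [h, coupling, coupling, ← Finset.sum_add_distrib]
  exact Finset.sum_congr rfl fun j hj => by rw [(hb j hj).dx_mul (hψ j hj)]

theorem abs_coupling_le {x t D V : ℝ} (hb : ∀ j ∈ s, |b i j x t| ≤ D)
    (hψ : ∀ j ∈ s, |ψ j x t| ≤ V) : |coupling s b ψ i x t| ≤ s.card * (D * V) := by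
  refine (Finset.abs_sum_le_sum_abs _ _).trans ?_
  rw [← nsmul_eq_mul]
  refine Finset.sum_le_card_nsmul _ _ _ fun j hj => ?_
  rw [abs_mul]
  exact mul_le_mul (hb j hj) (hψ j hj) (abs_nonneg _) ((abs_nonneg _).trans (hb j hj))

end coupling

/-- The right-hand side of the equation for the second `x`-derivative of a solution. -/
noncomputable def sndSource (s : Finset ℕ) (a : ℕ → ℕ → ℝ → ℝ → ℝ) (f v : ℕ → ℝ → ℝ → ℝ)
    (i : ℕ) (x t : ℝ) : ℝ :=
  dx (dx (f i)) x t - coupling s (fun i j => dx (dx (a i j))) v i x t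
    - coupling s (fun i j => dx (a i j)) (fun j => dx (v j)) i x t
    - coupling s (fun i j => dx (a i j)) (fun j => dx (v j)) i x t

/-- The right-hand side of the equation for the third `x`-derivative of a solution. -/
noncomputable def trdSource (s : Finset ℕ) (a : ℕ → ℕ → ℝ → ℝ → ℝ) (f v : ℕ → ℝ → ℝ → ℝ)
    (i : ℕ) (x t : ℝ) : ℝ :=
  dx (dx (dx (f i))) x t - coupling s (fun i j => dx (dx (dx (a i j)))) v i x t
    - 3 * coupling s (fun i j => dx (dx (a i j))) (fun j => dx (v j)) i x t
    - 3 * coupling s (fun i j => dx (a i j)) (fun j => dx (dx (v j))) i x t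

section differentiatedEquations

variable {s : Finset ℕ} {T : ℝ} {c : ℕ → ℝ} {a : ℕ → ℕ → ℝ → ℝ → ℝ} {f v : ℕ → ℝ → ℝ → ℝ}
  {i : ℕ}

theorem parabolicOp_dx_dx_eq (hi : i ∈ s) (ha : ∀ i ∈ s, ∀ j ∈ s, Smooth₂ (a i j))
    (hf : ∀ i ∈ s, Smooth₂ (f i)) (hv : ∀ i ∈ s, Smooth₂ (v i))
    (h : ∀ i ∈ s, ∀ x ∈ Set.Icc (0:ℝ) 1, ∀ t ∈ Set.Icc (0:ℝ) T,
      parabolicOp s c a v i x t = f i x t) :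
    ∀ x ∈ Set.Icc (0:ℝ) 1, ∀ t ∈ Set.Icc (0:ℝ) T,
      parabolicOp s c a (fun j => dx (dx (v j))) i x t = sndSource s a f v i x t := by
  have hC : Smooth₂ (coupling s (fun i j => dx (a i j)) v i) :=
    Smooth₂.coupling (fun j hj => (ha i hi j hj).dx) hv
  have hfst := parabolicOp_dx_eq c hi (ha i hi) hv (hf i hi) (h i hi)
  have hsnd := parabolicOp_dx_eq (ψ := fun j => dx (v j))
    (k := fun x t => dx (f i) x t - coupling s (fun i j => dx (a i j)) v i x t)
    c hi (ha i hi) (fun j hj => (hv j hj).dx) ((hf i hi).dx.sub hC) hfst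
  intro x hx t ht
  rw [hsnd x hx t ht, (hf i hi).dx.dx_sub hC]
  simp only [dx_coupling (b := fun i j => dx (a i j)) (fun j hj => (ha i hi j hj).dx) hv,
    sndSource]
  simp only [coupling]
  ring

theorem Smooth₂.sndSource (hi : i ∈ s) (ha : ∀ i ∈ s, ∀ j ∈ s, Smooth₂ (a i j))
    (hf : ∀ i ∈ s, Smooth₂ (f i)) (hv : ∀ i ∈ s, Smooth₂ (v i)) :
    Smooth₂ (sndSource s a f v i) := by
  have h := Smooth₂.coupling (i := i) (b := fun i j => dx (a i j)) (ψ := fun j => dx (v j))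
    (fun j hj => (ha i hi j hj).dx) (fun j hj => (hv j hj).dx)
  exact (((hf i hi).dx.dx.sub
    (Smooth₂.coupling (b := fun i j => dx (dx (a i j))) (fun j hj => (ha i hi j hj).dx.dx) hv)).sub
      h).sub h

theorem parabolicOp_dx_dx_dx_eq (hi : i ∈ s) (ha : ∀ i ∈ s, ∀ j ∈ s, Smooth₂ (a i j))
    (hf : ∀ i ∈ s, Smooth₂ (f i)) (hv : ∀ i ∈ s, Smooth₂ (v i))
    (h : ∀ i ∈ s, ∀ x ∈ Set.Icc (0:ℝ) 1, ∀ t ∈ Set.Icc (0:ℝ) T,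
      parabolicOp s c a v i x t = f i x t) :
    ∀ x ∈ Set.Icc (0:ℝ) 1, ∀ t ∈ Set.Icc (0:ℝ) T,
      parabolicOp s c a (fun j => dx (dx (dx (v j)))) i x t = trdSource s a f v i x t := by
  have ha' : ∀ j ∈ s, Smooth₂ (dx (a i j)) := fun j hj => (ha i hi j hj).dx
  have ha'' : ∀ j ∈ s, Smooth₂ (dx (dx (a i j))) := fun j hj => (ha' j hj).dx
  have hv' : ∀ j ∈ s, Smooth₂ (dx (v j)) := fun j hj => (hv j hj).dx
  have hC₁ := Smooth₂.coupling (i := i) (b := fun i j => dx (a i j)) (ψ := fun j => dx (v j))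
    ha' hv'
  have hC₂ := Smooth₂.coupling (i := i) (b := fun i j => dx (dx (a i j))) ha'' hv
  have hthird := parabolicOp_dx_eq (ψ := fun j => dx (dx (v j))) c hi (ha i hi)
    (fun j hj => (hv' j hj).dx) (Smooth₂.sndSource hi ha hf hv)
    (parabolicOp_dx_dx_eq hi ha hf hv h)
  intro x hx t ht
  have hd : dx (sndSource s a f v i) x t = dx (dx (dx (f i))) x t
      - dx (coupling s (fun i j => dx (dx (a i j))) v i) x t
      - dx (coupling s (fun i j => dx (a i j)) (fun j => dx (v j)) i) x t
      - dx (coupling s (fun i j => dx (a i j)) (fun j => dx (v j)) i) x t := by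
    have hf'' := (hf i hi).dx.dx
    have h₁ := ((hf''.sub hC₂).sub hC₁).dx_sub hC₁
    rw [(hf''.sub hC₂).dx_sub hC₁, hf''.dx_sub hC₂] at h₁
    exact congrFun (congrFun h₁ x) t
  rw [hthird x hx t ht, hd, dx_coupling (b := fun i j => dx (dx (a i j))) ha'' hv,
    dx_coupling (b := fun i j => dx (a i j)) (ψ := fun j => dx (v j)) ha' hv', trdSource]
  simp only [coupling]
  ring

end differentiatedEquations

/-- Uniform bounds of the first and second `x`-derivatives when the second derivative vanishes
on the sides. -/
theorem exists_bound_dx_dx_dx (s : Finset ℕ) (T : ℝ) {α V P A₁ A₂ F₂ : ℝ} (hα : 0 < α)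
    (hV : 0 ≤ V) (hP : 0 ≤ P) (hA₁ : 0 ≤ A₁) (hA₂ : 0 ≤ A₂) (hF₂ : 0 ≤ F₂) :
    ∃ N V₁ : ℝ, 0 ≤ N ∧ 0 ≤ V₁ ∧ ∀ (c : ℕ → ℝ) (a : ℕ → ℕ → ℝ → ℝ → ℝ) (f v : ℕ → ℝ → ℝ → ℝ),
      (∀ i ∈ s, 0 ≤ c i) →
      (∀ i ∈ s, ∀ j ∈ s, i ≠ j → ∀ x ∈ Set.Icc (0:ℝ) 1, ∀ t ∈ Set.Icc (0:ℝ) T,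
        a i j x t ≤ 0) →
      (∀ i ∈ s, ∀ x ∈ Set.Icc (0:ℝ) 1, ∀ t ∈ Set.Icc (0:ℝ) T, α < ∑ j ∈ s, a i j x t) →
      (∀ i ∈ s, ∀ j ∈ s, Smooth₂ (a i j)) → (∀ i ∈ s, Smooth₂ (f i)) →
      (∀ i ∈ s, Smooth₂ (v i)) →
      (∀ i ∈ s, ∀ x ∈ Set.Icc (0:ℝ) 1, ∀ t ∈ Set.Icc (0:ℝ) T,
        parabolicOp s c a v i x t = f i x t) →
      (∀ i ∈ s, ∀ j ∈ s, ∀ x ∈ Set.Icc (0:ℝ) 1, ∀ t ∈ Set.Icc (0:ℝ) T,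
        |dx (a i j) x t| ≤ A₁) →
      (∀ i ∈ s, ∀ j ∈ s, ∀ x ∈ Set.Icc (0:ℝ) 1, ∀ t ∈ Set.Icc (0:ℝ) T,
        |dx (dx (a i j)) x t| ≤ A₂) →
      (∀ i ∈ s, ∀ x ∈ Set.Icc (0:ℝ) 1, ∀ t ∈ Set.Icc (0:ℝ) T, |dx (dx (f i)) x t| ≤ F₂) →
      (∀ i ∈ s, ∀ x ∈ Set.Icc (0:ℝ) 1, ∀ t ∈ Set.Icc (0:ℝ) T, |v i x t| ≤ V) →
      (∀ i ∈ s, ∀ x ∈ Set.Icc (0:ℝ) 1, |dx (dx (v i)) x 0| ≤ P) →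
      (∀ i ∈ s, ∀ t ∈ Set.Icc (0:ℝ) T, dx (dx (v i)) 0 t = 0 ∧ dx (dx (v i)) 1 t = 0) →
      ∀ i ∈ s, ∀ x ∈ Set.Icc (0:ℝ) 1, ∀ t ∈ Set.Icc (0:ℝ) T,
        |dx (dx (v i)) x t| ≤ N ∧ |dx (v i) x t| ≤ V₁ := by
  set m : ℝ := (s.card : ℝ) with hm
  have hm0 : 0 ≤ m := Nat.cast_nonneg _
  set δ := α / (4 * (m * A₁) + α) with hδdef
  have hmA : 0 ≤ m * A₁ := mul_nonneg hm0 hA₁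
  have hden : 0 < 4 * (m * A₁) + α := by linarith
  have hδ : 0 < δ := div_pos hα hden
  have hδ1 : δ ≤ 1 := (div_le_one hden).2 (by linarith)
  have hδA : 4 * (m * A₁) * δ ≤ α := by
    have : δ * (4 * (m * A₁) + α) = α := div_mul_cancel₀ _ hden.ne'
    nlinarith [mul_pos hδ hα]
  set S := F₂ + m * (A₂ * V) + 2 * (m * (A₁ * (2 * V / δ))) with hS
  have hS0 : 0 ≤ S := by positivity
  set N := 2 * (P + S / α) with hN
  have hN0 : 0 ≤ N := by positivity
  refine ⟨N, 2 * V / δ + N * δ, hN0, by positivity, ?_⟩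
  intro c a f v hc hoff hrow ha hf hv hpde hA₁b hA₂b hF₂b hVb hPb hside
  have hinterp : ∀ B : ℝ, (∀ i ∈ s, ∀ x ∈ Set.Icc (0:ℝ) 1, ∀ t ∈ Set.Icc (0:ℝ) T,
      |dx (dx (v i)) x t| ≤ B) → ∀ i ∈ s, ∀ x ∈ Set.Icc (0:ℝ) 1, ∀ t ∈ Set.Icc (0:ℝ) T,
      |dx (v i) x t| ≤ 2 * V / δ + B * δ := fun B hB i hi x hx t ht =>
    abs_deriv_le_interpolation ((hv i hi).differentiable_left t)
      ((hv i hi).dx.differentiable_left t) hδ hδ1 (fun y hy => hVb i hi y hy t ht)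
      (fun y hy => hB i hi y hy t ht) x hx
  have himprove : ∀ B : ℝ, 0 ≤ B → (∀ i ∈ s, ∀ x ∈ Set.Icc (0:ℝ) 1, ∀ t ∈ Set.Icc (0:ℝ) T,
      |dx (dx (v i)) x t| ≤ B) → ∀ i ∈ s, ∀ x ∈ Set.Icc (0:ℝ) 1, ∀ t ∈ Set.Icc (0:ℝ) T,
      |dx (dx (v i)) x t| ≤ N / 2 + B / 2 := by
    intro B hB0 hB
    have hK0 : 0 ≤ N / 2 + B / 2 := by positivity
    refine abs_le_of_abs_parabolicOp_le_const hα hc hoff hrow (fun i hi => (hv i hi).dx.dx) hK0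
      (fun i hi x hx => (hPb i hi x hx).trans ?_) (fun i hi t ht => Or.inr ?_) ?_
    · have : 0 ≤ S / α := by positivity
      linarith
    · rw [(hside i hi t ht).1, (hside i hi t ht).2, abs_zero]
      exact ⟨hK0, hK0⟩
    · intro i hi x hx t ht
      rw [parabolicOp_dx_dx_eq hi ha hf hv hpde x hx t ht, sndSource]
      have h₁ := abs_coupling_le (i := i) (b := fun i j => dx (dx (a i j))) (ψ := v)
        (fun j hj => hA₂b i hi j hj x hx t ht) (fun j hj => hVb j hj x hx t ht)
      have h₂ := abs_coupling_le (i := i) (b := fun i j => dx (a i j)) (ψ := fun j => dx (v j))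
        (fun j hj => hA₁b i hi j hj x hx t ht) (fun j hj => hinterp B hB j hj x hx t ht)
      have h₃ := hF₂b i hi x hx t ht
      have hαS : α * (S / α) = S := mul_div_cancel₀ _ hα.ne'
      have hαK : α * (N / 2 + B / 2) = α * P + S + α * B / 2 := by rw [hN]; linarith
      have hαP : 0 ≤ α * P := mul_nonneg hα.le hP
      have hexp : m * (A₁ * (2 * V / δ + B * δ)) = m * (A₁ * (2 * V / δ)) + m * A₁ * δ * B := by
        ring
      have hδB : 4 * (m * A₁) * δ * B ≤ α * B := mul_le_mul_of_nonneg_right hδA hB0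
      rw [← hm] at h₁ h₂
      rw [hexp] at h₂
      rw [hαK]
      rw [abs_le] at *
      constructor <;> linarith
  obtain ⟨B, hB0, hB⟩ := exists_bound_of_smooth₂ s T (F := fun i => dx (dx (v i)))
    fun i hi => (hv i hi).dx.dx
  have hiter : ∀ k : ℕ, ∀ i ∈ s, ∀ x ∈ Set.Icc (0:ℝ) 1, ∀ t ∈ Set.Icc (0:ℝ) T,
      |dx (dx (v i)) x t| ≤ N + B * (1 / 2) ^ k := by
    intro k
    induction k with
    | zero =>
      intro i hi x hx t ht
      have := hB i hi x hx t ht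
      simp only [pow_zero, mul_one]
      linarith
    | succ k ih =>
      intro i hi x hx t ht
      have := himprove _ (by positivity) ih i hi x hx t ht
      rw [pow_succ]
      linarith
  have hNb : ∀ i ∈ s, ∀ x ∈ Set.Icc (0:ℝ) 1, ∀ t ∈ Set.Icc (0:ℝ) T,
      |dx (dx (v i)) x t| ≤ N := by
    intro i hi x hx t ht
    have hlim : Filter.Tendsto (fun k : ℕ => N + B * (1 / 2 : ℝ) ^ k) Filter.atTop
        (nhds (N + B * 0)) :=
      ((tendsto_pow_atTop_nhds_zero_of_lt_one (by norm_num) (by norm_num)).const_mul B).const_add N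
    rw [mul_zero, add_zero] at hlim
    exact ge_of_tendsto' hlim fun k => hiter k i hi x hx t ht
  exact fun i hi x hx t ht => ⟨hNb i hi x hx t ht, hinterp N hNb i hi x hx t ht⟩

/-- Layer-adapted bound of the `x`-derivative of a bounded solution vanishing on the sides. -/
theorem exists_layer_bound_dx (n : ℕ) (T : ℝ) {α D N P K₀ K₁ : ℝ} (hT : 0 ≤ T) (hα : 0 < α)
    (hD : 0 ≤ D) (hN : 0 ≤ N) (hP : 0 ≤ P) (hK₀ : 0 ≤ K₀) (hK₁ : 0 ≤ K₁) :
    ∃ C : ℝ, 0 ≤ C ∧ ∀ (ε : ℕ → ℝ) (a : ℕ → ℕ → ℝ → ℝ → ℝ) (Z : ℕ → ℝ → ℝ → ℝ),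
      (∀ i ∈ Finset.Icc 1 n, 0 < ε i) → (∀ i ∈ Finset.Icc 1 n, ε i ≤ 1) →
      (∀ i ∈ Finset.Icc 1 n, ∀ j ∈ Finset.Icc 1 n, i ≤ j → ε i ≤ ε j) →
      (∀ i ∈ Finset.Icc 1 n, ∀ j ∈ Finset.Icc 1 n, i ≠ j →
        ∀ x ∈ Set.Icc (0:ℝ) 1, ∀ t ∈ Set.Icc (0:ℝ) T, a i j x t ≤ 0) →
      (∀ i ∈ Finset.Icc 1 n, ∀ x ∈ Set.Icc (0:ℝ) 1, ∀ t ∈ Set.Icc (0:ℝ) T,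
        α < ∑ j ∈ Finset.Icc 1 n, a i j x t) →
      (∀ i ∈ Finset.Icc 1 n, ∀ j ∈ Finset.Icc 1 n,
        ∀ x ∈ Set.Icc (0:ℝ) 1, ∀ t ∈ Set.Icc (0:ℝ) T, |a i j x t| ≤ D) →
      (∀ i ∈ Finset.Icc 1 n, Smooth₂ (Z i)) →
      (∀ i ∈ Finset.Icc 1 n, ∀ x ∈ Set.Icc (0:ℝ) 1, ∀ t ∈ Set.Icc (0:ℝ) T, |Z i x t| ≤ N) →
      (∀ i ∈ Finset.Icc 1 n, ∀ t ∈ Set.Icc (0:ℝ) T, Z i 0 t = 0 ∧ Z i 1 t = 0) →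
      (∀ i ∈ Finset.Icc 1 n, ∀ x ∈ Set.Icc (0:ℝ) 1, |dx (Z i) x 0| ≤ P) →
      (∀ i ∈ Finset.Icc 1 n, ∀ x ∈ Set.Icc (0:ℝ) 1, ∀ t ∈ Set.Icc (0:ℝ) T,
        |parabolicOp (Finset.Icc 1 n) ε a Z i x t| ≤ K₀) →
      (∀ i ∈ Finset.Icc 1 n, ∀ x ∈ Set.Icc (0:ℝ) 1, ∀ t ∈ Set.Icc (0:ℝ) T,
        |parabolicOp (Finset.Icc 1 n) ε a (fun j => dx (Z j)) i x t| ≤ K₁) →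
      ∀ i ∈ Finset.Icc 1 n, ∀ x ∈ Set.Icc (0:ℝ) 1, ∀ t ∈ Set.Icc (0:ℝ) T,
        |dx (Z i) x t| ≤
          C * (1 + ∑ q ∈ Finset.Icc i n, √(α / ε q) * layerFn (√(α / ε q)) x) := by
  set R := max 1 (n * D / α) with hRdef
  have hR : 1 ≤ R := le_max_left _ _
  have hRD : n * D ≤ R * α := (div_le_iff₀ hα).1 (le_max_right _ _)
  set M₀ := (K₀ + n * (D * N)) / α + P * (1 + 1 / √α) with hM₀
  have hM₀0 : 0 ≤ M₀ := by positivity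
  set M := M₀ + P + K₁ / α with hM
  have hM0 : 0 ≤ M := by positivity
  have hMM₀ : M₀ ≤ M := by have : 0 ≤ K₁ / α := by positivity
                           linarith
  have hMP : P ≤ M := by have : 0 ≤ K₁ / α := by positivity
                         linarith
  have hΛ := one_le_layerBase n hR
  refine ⟨M * layerBase n R ^ n, by positivity, ?_⟩
  intro ε a Z hε hε1 hmono hoff hrow hDb hZ hNb hside hbot hL₀ hL₁
  set s : ℕ → ℝ := fun q => √(α / ε q) with hs
  have hspos : ∀ i ∈ Finset.Icc 1 n, 0 < s i := fun i hi =>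
    Real.sqrt_pos.2 (div_pos hα (hε i hi))
  have hsε : ∀ i ∈ Finset.Icc 1 n, ε i * s i ^ 2 = α := fun i hi => by
    have := hε i hi
    simp only [hs]
    rw [Real.sq_sqrt (by positivity), mul_div_cancel₀ _ this.ne']
  have hanti : ∀ i ∈ Finset.Icc 1 n, ∀ j ∈ Finset.Icc 1 n, i ≤ j → s j ≤ s i :=
    fun i hi j hj hij => Real.sqrt_le_sqrt
      (div_le_div_of_nonneg_left hα.le (hε i hi) (hmono i hi j hj hij))
  have hzero : (0:ℝ) ∈ Set.Icc (0:ℝ) T := ⟨le_rfl, hT⟩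
  have hslope : ∀ x₀ : ℝ, x₀ = 0 ∨ x₀ = 1 → ∀ i ∈ Finset.Icc 1 n, ∀ t ∈ Set.Icc (0:ℝ) T,
      |dx (Z i) x₀ t| ≤ M₀ * s i := by
    intro x₀ hx₀ i hi
    have hx₀mem : x₀ ∈ Set.Icc (0:ℝ) 1 := by rcases hx₀ with rfl | rfl <;> simp
    have hZx₀ : Z i x₀ 0 = 0 := by
      rcases hx₀ with rfl | rfl
      exacts [(hside i hi 0 hzero).1, (hside i hi 0 hzero).2]
    refine abs_dx_le_of_side_zero (a := a i i) hα (hε i hi) (hε1 i hi) hP hx₀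
      (fun x hx t ht => ?_) (hZ i hi) (fun x hx => ?_) (hside i hi) (fun x hx t ht => ?_) ?_
    · have h := hrow i hi x hx t ht
      rw [← Finset.add_sum_erase _ _ hi] at h
      have h' : ∑ j ∈ (Finset.Icc 1 n).erase i, a i j x t ≤ 0 :=
        Finset.sum_nonpos fun j hj => hoff i hi j (Finset.mem_of_mem_erase hj)
          (Finset.ne_of_mem_erase hj).symm x hx t ht
      linarith
    · have h := (convex_Icc (0:ℝ) 1).norm_image_sub_le_of_norm_deriv_le
        (f := fun y => Z i y 0) (fun y _ => (hZ i hi).differentiable_left 0 y)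
        (fun y hy => hbot i hi y hy) hx₀mem hx
      simpa [hZx₀, Real.norm_eq_abs] using h
    · have heq : dt (Z i) x t - ε i * dx (dx (Z i)) x t + a i i x t * Z i x t =
          parabolicOp (Finset.Icc 1 n) ε a Z i x t -
            ∑ j ∈ (Finset.Icc 1 n).erase i, a i j x t * Z j x t := by
        rw [parabolicOp, ← Finset.add_sum_erase _ _ hi]; ring
      have hsum : |∑ j ∈ (Finset.Icc 1 n).erase i, a i j x t * Z j x t| ≤ n * (D * N) := by
        refine (Finset.abs_sum_le_sum_abs _ _).trans ?_
        refine (Finset.sum_le_sum_of_subset_of_nonneg (Finset.erase_subset i _)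
          fun j _ _ => abs_nonneg _).trans ?_
        have h := Finset.sum_le_card_nsmul (Finset.Icc 1 n) (fun j => |a i j x t * Z j x t|)
          (D * N) fun j hj => by
            rw [abs_mul]
            exact mul_le_mul (hDb i hi j hj x hx t ht) (hNb j hj x hx t ht) (abs_nonneg _) hD
        simpa [nsmul_eq_mul] using h
      have h₀ := hL₀ i hi x hx t ht
      have hαM : α * M₀ = K₀ + n * (D * N) + α * (P * (1 + 1 / √α)) := by
        rw [hM₀, mul_add, mul_div_cancel₀ _ hα.ne']
      have hpos : 0 ≤ α * (P * (1 + 1 / √α)) := by positivity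
      rw [heq, hαM]
      rw [abs_le] at *
      constructor <;> linarith
    · have : 0 ≤ (K₀ + n * (D * N)) / α := by positivity
      linarith
  have hge : ∀ i ∈ Finset.Icc 1 n, ∀ x ∈ Set.Icc (0:ℝ) 1,
      M * (1 + s i * layerFn (s i) x) ≤ M * layerBarrier n R s i x := fun i hi x hx =>
    mul_le_mul_of_nonneg_left (le_layerBarrier hR hspos hanti hi hx) hM0
  have hsideb : ∀ x₀ : ℝ, x₀ = 0 ∨ x₀ = 1 → ∀ i ∈ Finset.Icc 1 n, ∀ t ∈ Set.Icc (0:ℝ) T,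
      |dx (Z i) x₀ t| ≤ M * layerBarrier n R s i x₀ := by
    intro x₀ hx₀ i hi t ht
    have hx₀mem : x₀ ∈ Set.Icc (0:ℝ) 1 := by rcases hx₀ with rfl | rfl <;> simp
    refine (hslope x₀ hx₀ i hi t ht).trans (le_trans ?_ (hge i hi x₀ hx₀mem))
    have h₁ : s i ≤ 1 + s i * layerFn (s i) x₀ := by
      nlinarith [hspos i hi, one_le_layerFn (s := s i) hx₀]
    exact mul_le_mul hMM₀ h₁ (hspos i hi).le hM0
  have hmain := abs_le_of_abs_parabolicOp_le (T := T) (c := ε) (a := a)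
    (y := fun j => dx (Z j)) (Ψ := fun j x _ => M * layerBarrier n R s j x)
    (fun i hi => (hε i hi).le) hoff (fun i hi x hx t ht => hα.trans (hrow i hi x hx t ht))
    (fun i hi => (hZ i hi).dx)
    (fun i _ => contDiff_const.mul ((contDiff_layerBarrier n R s i).comp contDiff_fst))
    (fun i hi x hx => ((hbot i hi x hx).trans hMP).trans (le_trans (by
      have := mul_pos (hspos i hi) (layerFn_pos (s i) x)
      nlinarith) (hge i hi x hx)))
    (fun i hi t ht => Or.inr
      ⟨hsideb 0 (Or.inl rfl) i hi t ht, hsideb 1 (Or.inr rfl) i hi t ht⟩)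
    (fun i hi x hx t ht => by
      refine (hL₁ i hi x hx t ht).trans ?_
      rw [parabolicOp_of_indep ε a (fun j x => M * layerBarrier n R s j x)]
      have hd : deriv (deriv (fun y => M * layerBarrier n R s i y)) x =
          M * deriv (deriv (layerBarrier n R s i)) x := by
        simp only [deriv_const_mul_field']
      have hsup := layerBarrier_supersolution (b := fun j => a i j x t) hR hα hspos hmono hsε hRD hi
        (fun j hj hij => hoff i hi j hj hij x hx t ht) (hrow i hi x hx t ht)
        (fun j hj => hDb i hi j hj x hx t ht) x
      have hfac : -(ε i * deriv (deriv (fun y => M * layerBarrier n R s i y)) x) +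
          ∑ j ∈ Finset.Icc 1 n, a i j x t * (M * layerBarrier n R s j x) =
          M * (-(ε i * deriv (deriv (layerBarrier n R s i)) x) +
            ∑ j ∈ Finset.Icc 1 n, a i j x t * layerBarrier n R s j x) := by
        rw [hd, mul_add, Finset.mul_sum]
        congr 1
        · ring
        · exact Finset.sum_congr rfl fun j _ => by ring
      rw [hfac]
      refine le_trans ?_ (mul_le_mul_of_nonneg_left hsup hM0)
      have : K₁ / α ≤ M := by linarith
      exact (div_le_iff₀ hα).1 this)
  intro i hi x hx t ht
  refine (hmain i hi x hx t ht).trans ?_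
  rw [mul_assoc]
  exact mul_le_mul_of_nonneg_left (layerBarrier_le hR hspos hi x) hM0

theorem dx_eq_of_eq_bottom {F G : ℝ → ℝ → ℝ} (hF : Smooth₂ F) (hG : Smooth₂ G)
    (h : ∀ x ∈ Set.Icc (0:ℝ) 1, F x 0 = G x 0) :
    ∀ x ∈ Set.Icc (0:ℝ) 1, dx F x 0 = dx G x 0 := fun _ hx =>
  deriv_eq_of_eqOn_Icc zero_lt_one (hF.differentiable_left 0) (hG.differentiable_left 0)
    (fun y hy => h y hy) hx

/-- The second `x`-derivative of the smooth component vanishes where it agrees in time with the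
reduced solution. -/
theorem dx_dx_eq_zero_of_eq_reduced {s : Finset ℕ} {T x : ℝ} {ε : ℕ → ℝ}
    {a : ℕ → ℕ → ℝ → ℝ → ℝ} {f u v : ℕ → ℝ → ℝ → ℝ} (hT : 0 < T) (hε : ∀ i ∈ s, 0 < ε i)
    (hu : ∀ i ∈ s, Smooth₂ (u i)) (hv : ∀ i ∈ s, Smooth₂ (v i))
    (hured : ∀ i ∈ s, ∀ t ∈ Set.Icc (0:ℝ) T,
      parabolicOp s (fun _ => 0) a u i x t = f i x t)
    (hvpde : ∀ i ∈ s, ∀ t ∈ Set.Icc (0:ℝ) T, parabolicOp s ε a v i x t = f i x t)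
    (huv : ∀ i ∈ s, ∀ t ∈ Set.Icc (0:ℝ) T, v i x t = u i x t) :
    ∀ i ∈ s, ∀ t ∈ Set.Icc (0:ℝ) T, dx (dx (v i)) x t = 0 := by
  intro i hi t ht
  have hdt : dt (v i) x t = dt (u i) x t :=
    deriv_eq_of_eqOn_Icc hT ((hv i hi).differentiable_right x)
      ((hu i hi).differentiable_right x) (fun r hr => huv i hi r hr) ht
  have hsum : ∑ j ∈ s, a i j x t * v j x t = ∑ j ∈ s, a i j x t * u j x t :=
    Finset.sum_congr rfl fun j hj => by rw [huv j hj t ht]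
  have h := (hvpde i hi t ht).trans (hured i hi t ht).symm
  rw [parabolicOp, parabolicOp, hdt, hsum] at h
  have h' : ε i * dx (dx (v i)) x t = 0 := by linarith
  exact (mul_eq_zero.1 h').resolve_left (hε i hi).ne'

/-- Bounds of the smooth component and its first three `x`-derivatives, uniform in the
perturbation parameters. -/
theorem exists_bound_smooth_component (n : ℕ) {T α : ℝ} (hT : 0 < T) (hα : 0 < α)
    {a : ℕ → ℕ → ℝ → ℝ → ℝ} {f φ : ℕ → ℝ → ℝ → ℝ}
    (ha : ∀ i ∈ Finset.Icc 1 n, ∀ j ∈ Finset.Icc 1 n, Smooth₂ (a i j))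
    (hoff : ∀ i ∈ Finset.Icc 1 n, ∀ j ∈ Finset.Icc 1 n, i ≠ j →
      ∀ x ∈ Set.Icc (0:ℝ) 1, ∀ t ∈ Set.Icc (0:ℝ) T, a i j x t ≤ 0)
    (hrow : ∀ i ∈ Finset.Icc 1 n, ∀ x ∈ Set.Icc (0:ℝ) 1, ∀ t ∈ Set.Icc (0:ℝ) T,
      α < ∑ j ∈ Finset.Icc 1 n, a i j x t)
    (hf : ∀ i ∈ Finset.Icc 1 n, Smooth₂ (f i)) (hφ : ∀ i ∈ Finset.Icc 1 n, Smooth₂ (φ i)) :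
    ∃ C : ℝ, 0 < C ∧ ∀ (ε : ℕ → ℝ) (u v : ℕ → ℝ → ℝ → ℝ),
      (∀ i ∈ Finset.Icc 1 n, 0 < ε i) → (∀ i ∈ Finset.Icc 1 n, ε i ≤ 1) →
      (∀ i ∈ Finset.Icc 1 n, ∀ j ∈ Finset.Icc 1 n, i ≤ j → ε i ≤ ε j) →
      (∀ i ∈ Finset.Icc 1 n, Smooth₂ (u i)) → (∀ i ∈ Finset.Icc 1 n, Smooth₂ (v i)) →
      (∀ i ∈ Finset.Icc 1 n, ∀ x ∈ Set.Icc (0:ℝ) 1, ∀ t ∈ Set.Icc (0:ℝ) T,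
        parabolicOp (Finset.Icc 1 n) (fun _ => 0) a u i x t = f i x t) →
      (∀ i ∈ Finset.Icc 1 n, ∀ x ∈ Set.Icc (0:ℝ) 1, u i x 0 = φ i x 0) →
      (∀ i ∈ Finset.Icc 1 n, ∀ x ∈ Set.Icc (0:ℝ) 1, ∀ t ∈ Set.Icc (0:ℝ) T,
        parabolicOp (Finset.Icc 1 n) ε a v i x t = f i x t) →
      (∀ i ∈ Finset.Icc 1 n, ∀ x ∈ Set.Icc (0:ℝ) 1, ∀ t ∈ Set.Icc (0:ℝ) T,
        (x = 0 ∨ x = 1 ∨ t = 0) → v i x t = u i x t) →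
      ∀ i ∈ Finset.Icc 1 n, ∀ x ∈ Set.Icc (0:ℝ) 1, ∀ t ∈ Set.Icc (0:ℝ) T,
        |v i x t| ≤ C ∧ |dx (v i) x t| ≤ C ∧ |dx (dx (v i)) x t| ≤ C ∧
        |dx (dx (dx (v i))) x t| ≤
          C * (1 + ∑ q ∈ Finset.Icc i n, √(α / ε q) * layerFn (√(α / ε q)) x) := by
  obtain ⟨A₀, hA₀, hA₀b⟩ := exists_bound_of_smooth₂_matrix _ T ha
  obtain ⟨A₁, hA₁, hA₁b⟩ := exists_bound_of_smooth₂_matrix _ T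
    (F := fun i j => dx (a i j)) fun i hi j hj => (ha i hi j hj).dx
  obtain ⟨A₂, hA₂, hA₂b⟩ := exists_bound_of_smooth₂_matrix _ T
    (F := fun i j => dx (dx (a i j))) fun i hi j hj => (ha i hi j hj).dx.dx
  obtain ⟨A₃, hA₃, hA₃b⟩ := exists_bound_of_smooth₂_matrix _ T
    (F := fun i j => dx (dx (dx (a i j)))) fun i hi j hj => (ha i hi j hj).dx.dx.dx
  obtain ⟨F₀, hF₀, hF₀b⟩ := exists_bound_of_smooth₂ _ T hf
  obtain ⟨F₂, hF₂, hF₂b⟩ := exists_bound_of_smooth₂ _ T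
    (F := fun i => dx (dx (f i))) fun i hi => (hf i hi).dx.dx
  obtain ⟨F₃, hF₃, hF₃b⟩ := exists_bound_of_smooth₂ _ T
    (F := fun i => dx (dx (dx (f i)))) fun i hi => (hf i hi).dx.dx.dx
  obtain ⟨Φ₀, hΦ₀, hΦ₀b⟩ := exists_bound_of_smooth₂ _ T hφ
  obtain ⟨Φ₂, hΦ₂, hΦ₂b⟩ := exists_bound_of_smooth₂ _ T
    (F := fun i => dx (dx (φ i))) fun i hi => (hφ i hi).dx.dx
  obtain ⟨Φ₃, hΦ₃, hΦ₃b⟩ := exists_bound_of_smooth₂ _ T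
    (F := fun i => dx (dx (dx (φ i)))) fun i hi => (hφ i hi).dx.dx.dx
  have hzero : (0:ℝ) ∈ Set.Icc (0:ℝ) T := ⟨le_rfl, hT.le⟩
  set V := Φ₀ + F₀ / α with hVdef
  have hF₀α : 0 ≤ F₀ / α := by positivity
  have hV : 0 ≤ V := by positivity
  have hΦV : Φ₀ ≤ V := by linarith
  have hFV : F₀ ≤ α * V := by
    rw [hVdef, mul_add, mul_div_cancel₀ _ hα.ne']
    nlinarith [mul_nonneg hα.le hΦ₀]
  obtain ⟨N, V₁, hN, hV₁, hNV⟩ :=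
    exists_bound_dx_dx_dx (Finset.Icc 1 n) T hα hV hΦ₂ hA₁ hA₂ hF₂
  obtain ⟨C₃, hC₃, hlayer⟩ := exists_layer_bound_dx n T (N := N)
    (K₀ := F₂ + n * (A₂ * V) + 2 * (n * (A₁ * V₁)))
    (K₁ := F₃ + n * (A₃ * V) + 3 * (n * (A₂ * V₁)) + 3 * (n * (A₁ * N))) hT.le hα hA₀ hN hΦ₃
    (by positivity) (by positivity)
  refine ⟨V + V₁ + N + C₃ + 1, by positivity, ?_⟩
  intro ε u v hε hε1 hmono hu hv hured hubot hvpde hvu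
  have hub : ∀ i ∈ Finset.Icc 1 n, ∀ x ∈ Set.Icc (0:ℝ) 1, ∀ t ∈ Set.Icc (0:ℝ) T,
      |u i x t| ≤ V := by
    refine abs_le_of_abs_parabolicOp_le_const hα (fun _ _ => le_rfl) hoff hrow hu hV
      (fun i hi x hx => ?_) (fun _ _ _ _ => Or.inl rfl) fun i hi x hx t ht => ?_
    · rw [hubot i hi x hx]
      exact (hΦ₀b i hi x hx 0 hzero).trans hΦV
    · rw [hured i hi x hx t ht]
      exact (hF₀b i hi x hx t ht).trans hFV
  have h0 : (0:ℝ) ∈ Set.Icc (0:ℝ) 1 := by simp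
  have h1 : (1:ℝ) ∈ Set.Icc (0:ℝ) 1 := by simp
  have hvb : ∀ i ∈ Finset.Icc 1 n, ∀ x ∈ Set.Icc (0:ℝ) 1, ∀ t ∈ Set.Icc (0:ℝ) T,
      |v i x t| ≤ V := by
    refine abs_le_of_abs_parabolicOp_le_const hα (fun i hi => (hε i hi).le) hoff hrow hv hV
      (fun i hi x hx => ?_) (fun i hi t ht => Or.inr ⟨?_, ?_⟩) fun i hi x hx t ht => ?_
    · rw [hvu i hi x hx 0 hzero (by simp)]
      exact hub i hi x hx 0 hzero
    · rw [hvu i hi 0 h0 t ht (by simp)]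
      exact hub i hi 0 h0 t ht
    · rw [hvu i hi 1 h1 t ht (by simp)]
      exact hub i hi 1 h1 t ht
    · rw [hvpde i hi x hx t ht]
      exact (hF₀b i hi x hx t ht).trans hFV
  have hbot : ∀ i ∈ Finset.Icc 1 n, ∀ x ∈ Set.Icc (0:ℝ) 1, v i x 0 = φ i x 0 :=
    fun i hi x hx => (hvu i hi x hx 0 hzero (by simp)).trans (hubot i hi x hx)
  have hbot₂ : ∀ i ∈ Finset.Icc 1 n, ∀ x ∈ Set.Icc (0:ℝ) 1,
      dx (dx (v i)) x 0 = dx (dx (φ i)) x 0 := fun i hi =>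
    dx_eq_of_eq_bottom (hv i hi).dx (hφ i hi).dx
      (dx_eq_of_eq_bottom (hv i hi) (hφ i hi) (hbot i hi))
  have hbot₃ : ∀ i ∈ Finset.Icc 1 n, ∀ x ∈ Set.Icc (0:ℝ) 1,
      dx (dx (dx (v i))) x 0 = dx (dx (dx (φ i))) x 0 := fun i hi =>
    dx_eq_of_eq_bottom (hv i hi).dx.dx (hφ i hi).dx.dx (hbot₂ i hi)
  have hside : ∀ i ∈ Finset.Icc 1 n, ∀ t ∈ Set.Icc (0:ℝ) T,
      dx (dx (v i)) 0 t = 0 ∧ dx (dx (v i)) 1 t = 0 := fun i hi t ht =>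
    ⟨dx_dx_eq_zero_of_eq_reduced hT hε hu hv (fun j hj => hured j hj 0 h0)
        (fun j hj => hvpde j hj 0 h0) (fun j hj r hr => hvu j hj 0 h0 r hr (by simp)) i hi t ht,
      dx_dx_eq_zero_of_eq_reduced hT hε hu hv (fun j hj => hured j hj 1 h1)
        (fun j hj => hvpde j hj 1 h1) (fun j hj r hr => hvu j hj 1 h1 r hr (by simp)) i hi t ht⟩
  have hderiv := hNV ε a f v (fun i hi => (hε i hi).le) hoff hrow ha hf hv hvpde hA₁b hA₂b hF₂b
    hvb (fun i hi x hx => by rw [hbot₂ i hi x hx]; exact hΦ₂b i hi x hx 0 hzero) hside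
  have hthird := hlayer ε a (fun i => dx (dx (v i))) hε hε1 hmono hoff hrow hA₀b
    (fun i hi => (hv i hi).dx.dx) (fun i hi x hx t ht => (hderiv i hi x hx t ht).1) hside
    (fun i hi x hx => by rw [hbot₃ i hi x hx]; exact hΦ₃b i hi x hx 0 hzero)
    (fun i hi x hx t ht => by
      rw [parabolicOp_dx_dx_eq hi ha hf hv hvpde x hx t ht, sndSource]
      have h₁ := abs_coupling_le (i := i) (b := fun i j => dx (dx (a i j))) (ψ := v)
        (fun j hj => hA₂b i hi j hj x hx t ht) (fun j hj => hvb j hj x hx t ht)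
      have h₂ := abs_coupling_le (i := i) (b := fun i j => dx (a i j)) (ψ := fun j => dx (v j))
        (fun j hj => hA₁b i hi j hj x hx t ht) (fun j hj => (hderiv j hj x hx t ht).2)
      have h₃ := hF₂b i hi x hx t ht
      rw [Nat.card_Icc, Nat.add_sub_cancel, abs_le] at h₁ h₂
      rw [abs_le] at h₃ ⊢
      constructor <;> linarith)
    (fun i hi x hx t ht => by
      rw [parabolicOp_dx_dx_dx_eq hi ha hf hv hvpde x hx t ht, trdSource]
      have h₁ := abs_coupling_le (i := i) (b := fun i j => dx (dx (dx (a i j)))) (ψ := v)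
        (fun j hj => hA₃b i hi j hj x hx t ht) (fun j hj => hvb j hj x hx t ht)
      have h₂ := abs_coupling_le (i := i) (b := fun i j => dx (dx (a i j)))
        (ψ := fun j => dx (v j))
        (fun j hj => hA₂b i hi j hj x hx t ht) (fun j hj => (hderiv j hj x hx t ht).2)
      have h₃ := abs_coupling_le (i := i) (b := fun i j => dx (a i j))
        (ψ := fun j => dx (dx (v j)))
        (fun j hj => hA₁b i hi j hj x hx t ht) (fun j hj => (hderiv j hj x hx t ht).1)
      have h₄ := hF₃b i hi x hx t ht
      rw [Nat.card_Icc, Nat.add_sub_cancel, abs_le] at h₁ h₂ h₃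
      rw [abs_le] at h₄ ⊢
      constructor <;> linarith)
  intro i hi x hx t ht
  refine ⟨(hvb i hi x hx t ht).trans (by linarith),
    (hderiv i hi x hx t ht).2.trans (by linarith),
    (hderiv i hi x hx t ht).1.trans (by linarith),
    (hthird i hi x hx t ht).trans (mul_le_mul_of_nonneg_right (by linarith) ?_)⟩
  exact add_nonneg zero_le_one (Finset.sum_nonneg fun q _ =>
    mul_nonneg (Real.sqrt_nonneg _) (layerFn_pos _ x).le)

/-- **Improved bounds for the smooth component** (Lemma 7 of the paper).
With the data `A`, `f` and boundary data `φ` fixed, there is a constant `C`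
independent of `ε₁,…,εₙ` such that the smooth component `v` satisfies, for
`l = 0,1,2,3`,
`|∂ₓ^l v_i(x,t)| ≤ C (1 + Σ_{q=i}^{n} B_q(x)/ε_q^{l/2-1})`, where
`B_q(x) = exp(−x√(α/ε_q)) + exp(−(1−x)√(α/ε_q))`. -/
theorem stmt_4
    (n : ℕ) (hn : 1 ≤ n) (T : ℝ) (hT : 0 < T)
    (A : ℕ → ℕ → ℝ → ℝ → ℝ)
    (hAsmooth : ∀ i ∈ Finset.Icc 1 n, ∀ j ∈ Finset.Icc 1 n,
      ContDiff ℝ (⊤ : ℕ∞) (fun p : ℝ × ℝ => A i j p.1 p.2))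
    (hAdiag : ∀ i ∈ Finset.Icc 1 n, ∀ x ∈ Set.Icc (0:ℝ) 1, ∀ t ∈ Set.Icc (0:ℝ) T,
      ∑ j ∈ (Finset.Icc 1 n).erase i, |A i j x t| < A i i x t)
    (hAoff : ∀ i ∈ Finset.Icc 1 n, ∀ j ∈ Finset.Icc 1 n, i ≠ j →
      ∀ x ∈ Set.Icc (0:ℝ) 1, ∀ t ∈ Set.Icc (0:ℝ) T, A i j x t ≤ 0)
    (α : ℝ) (hα : 0 < α)
    (hαA : ∀ x ∈ Set.Icc (0:ℝ) 1, ∀ t ∈ Set.Icc (0:ℝ) T, ∀ i ∈ Finset.Icc 1 n,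
      α < ∑ j ∈ Finset.Icc 1 n, A i j x t)
    (f φ : ℕ → ℝ → ℝ → ℝ)
    (hfsmooth : ∀ i ∈ Finset.Icc 1 n, ContDiff ℝ (⊤ : ℕ∞) (fun p : ℝ × ℝ => f i p.1 p.2))
    (hφsmooth : ∀ i ∈ Finset.Icc 1 n, ContDiff ℝ (⊤ : ℕ∞) (fun p : ℝ × ℝ => φ i p.1 p.2)) :
    ∃ C : ℝ, 0 < C ∧
      ∀ ε : ℕ → ℝ,
        (∀ i ∈ Finset.Icc 1 n, 0 < ε i) →
        (∀ i ∈ Finset.Icc 1 n, ε i ≤ 1) →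
        (∀ i j : ℕ, 1 ≤ i → i < j → j ≤ n → ε i < ε j) →
        ∀ u₀ v : ℕ → ℝ → ℝ → ℝ,
          (∀ i ∈ Finset.Icc 1 n, ContDiff ℝ (⊤ : ℕ∞) (fun p : ℝ × ℝ => u₀ i p.1 p.2)) →
          (∀ i ∈ Finset.Icc 1 n, ContDiff ℝ (⊤ : ℕ∞) (fun p : ℝ × ℝ => v i p.1 p.2)) →
          -- `u₀` solves the reduced problem `∂u₀/∂t + A u₀ = f` on `Ω`, `u₀ = φ` on `Γ_B`
          (∀ i ∈ Finset.Icc 1 n, ∀ x t : ℝ, 0 < x → x < 1 → 0 < t → t ≤ T →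
            deriv (fun s => u₀ i x s) t + ∑ j ∈ Finset.Icc 1 n, A i j x t * u₀ j x t
              = f i x t) →
          (∀ i ∈ Finset.Icc 1 n, ∀ x ∈ Set.Icc (0:ℝ) 1, u₀ i x 0 = φ i x 0) →
          -- `v` solves `Lv = f` on `Ω` with `v = u₀` on `Γ`
          (∀ i ∈ Finset.Icc 1 n, ∀ x t : ℝ, 0 < x → x < 1 → 0 < t → t ≤ T →
            deriv (fun s => v i x s) t - ε i * iteratedDeriv 2 (fun y => v i y t) x
              + ∑ j ∈ Finset.Icc 1 n, A i j x t * v j x t = f i x t) →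
          (∀ i ∈ Finset.Icc 1 n, ∀ x ∈ Set.Icc (0:ℝ) 1, ∀ t ∈ Set.Icc (0:ℝ) T,
            (x = 0 ∨ x = 1 ∨ t = 0) → v i x t = u₀ i x t) →
          ∀ i ∈ Finset.Icc 1 n, ∀ x ∈ Set.Icc (0:ℝ) 1, ∀ t ∈ Set.Icc (0:ℝ) T,
            ∀ l ≤ 3, |iteratedDeriv l (fun y => v i y t) x|
              ≤ C * (1 + ∑ q ∈ Finset.Icc i n,
                  (Real.exp (-x * Real.sqrt (α / ε q))
                    + Real.exp (-(1 - x) * Real.sqrt (α / ε q))) / ε q ^ ((l : ℝ) / 2 - 1)) := by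
  obtain ⟨C, hC, hbound⟩ := exists_bound_smooth_component n hT hα hAsmooth hAoff
    (fun i hi x hx t ht => hαA x hx t ht i hi) hfsmooth hφsmooth
  refine ⟨C * (1 + √α), by positivity, ?_⟩
  intro ε hε hε1 hεlt u₀ v hu hv hured hubot hvpde hvu i hi x hx t ht l hl
  have hmono : ∀ i ∈ Finset.Icc 1 n, ∀ j ∈ Finset.Icc 1 n, i ≤ j → ε i ≤ ε j := by
    intro i hi j hj hij
    rcases hij.eq_or_lt with rfl | hlt
    · exact le_rfl
    · exact (hεlt i j (Finset.mem_Icc.1 hi).1 hlt (Finset.mem_Icc.1 hj).2).le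
  have hured' : ∀ i ∈ Finset.Icc 1 n, ∀ x ∈ Set.Icc (0:ℝ) 1, ∀ t ∈ Set.Icc (0:ℝ) T,
      parabolicOp (Finset.Icc 1 n) (fun _ => 0) A u₀ i x t = f i x t := fun i hi =>
    eq_on_closed_rectangle hT (Smooth₂.parabolicOp _ hi (hAsmooth i hi) hu) (hfsmooth i hi)
      fun x t hx0 hx1 ht0 htT => by
        rw [← hured i hi x t hx0 hx1 ht0 htT, parabolicOp, zero_mul, sub_zero]
        rfl
  have hvpde' : ∀ i ∈ Finset.Icc 1 n, ∀ x ∈ Set.Icc (0:ℝ) 1, ∀ t ∈ Set.Icc (0:ℝ) T,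
      parabolicOp (Finset.Icc 1 n) ε A v i x t = f i x t := fun i hi =>
    eq_on_closed_rectangle hT (Smooth₂.parabolicOp _ hi (hAsmooth i hi) hv) (hfsmooth i hi)
      fun x t hx0 hx1 ht0 htT => by
        rw [← hvpde i hi x t hx0 hx1 ht0 htT, iteratedDeriv_two_eq_dx]
        rfl
  obtain ⟨h₀, h₁, h₂, h₃⟩ :=
    hbound ε u₀ v hε hε1 hmono hu hv hured' hubot hvpde' hvu i hi x hx t ht
  have hεpos : ∀ q ∈ Finset.Icc i n, 0 < ε q := fun q hq =>
    hε q (Finset.Icc_subset_Icc_left (Finset.mem_Icc.1 hi).1 hq)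
  have hsum : 0 ≤ ∑ q ∈ Finset.Icc i n, (Real.exp (-x * √(α / ε q))
      + Real.exp (-(1 - x) * √(α / ε q))) / ε q ^ ((l : ℝ) / 2 - 1) :=
    Finset.sum_nonneg fun q hq => by
      have := hεpos q hq
      positivity
  have hCα : C ≤ C * (1 + √α) :=
    le_mul_of_one_le_right hC.le (le_add_of_nonneg_right (Real.sqrt_nonneg _))
  have hCle : C ≤ C * (1 + √α) * (1 + ∑ q ∈ Finset.Icc i n, (Real.exp (-x * √(α / ε q))
      + Real.exp (-(1 - x) * √(α / ε q))) / ε q ^ ((l : ℝ) / 2 - 1)) :=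
    hCα.trans (le_mul_of_one_le_right (by positivity) (le_add_of_nonneg_right hsum))
  obtain rfl | rfl | rfl | rfl : l = 0 ∨ l = 1 ∨ l = 2 ∨ l = 3 := by omega
  · rw [iteratedDeriv_zero]
    exact h₀.trans hCle
  · rw [iteratedDeriv_one]
    exact h₁.trans hCle
  · rw [iteratedDeriv_two_eq_dx]
    exact h₂.trans hCle
  · rw [iteratedDeriv_three_eq_dx]
    refine h₃.trans ?_
    have heq : ∑ q ∈ Finset.Icc i n, √(α / ε q) * layerFn (√(α / ε q)) x =
        √α * ∑ q ∈ Finset.Icc i n, (Real.exp (-x * √(α / ε q))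
          + Real.exp (-(1 - x) * √(α / ε q))) / ε q ^ (((3 : ℕ) : ℝ) / 2 - 1) := by
      rw [Finset.mul_sum]
      refine Finset.sum_congr rfl fun q hq => ?_
      have hexp : ((3 : ℕ) : ℝ) / 2 - 1 = 1 / 2 := by norm_num
      rw [hexp, ← Real.sqrt_eq_rpow, layerFn, Real.sqrt_div hα.le]
      ring
    rw [heq, mul_assoc]
    refine mul_le_mul_of_nonneg_left ?_ hC.le
    nlinarith [Real.sqrt_nonneg α]
end

section
/- Discrete stability: for any vector mesh function Ψ on the grid and any mesh point (x_j,t_k), max_i |Ψ_i(x_j,t_k)| ≤ max{ ‖Ψ‖_{Γ^{M,N}} , (1/α)·‖L^{M,N}Ψ‖ }, where ‖Ψ‖_{Γ^{M,N}} is the maximum of max_i |Ψ_i| over the boundary mesh points (j = 0, j = N or k = 0) and ‖L^{M,N}Ψ‖ is the maximum of max_i |(L^{M,N}Ψ)_i| over the interior mesh points. -/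
/-- The discrete operator `L^{M,N}` applied to the vector mesh function `Ψ`
(component `i`, space index `j`, time index `k`), on an arbitrary mesh
`x : ℕ → ℝ`, `t : ℕ → ℝ`:
`L^{M,N}Ψ = D_t⁻ Ψ − ε_i δ_x² Ψ + Σ_l a_il Ψ_l`. -/
noncomputable def discreteL (n : ℕ) (ε : ℕ → ℝ) (A : ℕ → ℕ → ℝ → ℝ → ℝ)
    (x t : ℕ → ℝ) (Ψ : ℕ → ℕ → ℕ → ℝ) (i j k : ℕ) : ℝ :=
  (Ψ i j k - Ψ i j (k - 1)) / (t k - t (k - 1))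
    - ε i * (((Ψ i (j + 1) k - Ψ i j k) / (x (j + 1) - x j)
          - (Ψ i j k - Ψ i (j - 1) k) / (x j - x (j - 1)))
        / ((x (j + 1) - x (j - 1)) / 2))
    + ∑ l ∈ Finset.Icc 1 n, A i l (x j) (t k) * Ψ l j k

/-- The discrete operator is odd in the mesh function. -/
theorem discreteL_neg (n : ℕ) (ε : ℕ → ℝ) (A : ℕ → ℕ → ℝ → ℝ → ℝ)
    (x t : ℕ → ℝ) (Ψ : ℕ → ℕ → ℕ → ℝ) (i j k : ℕ) :
    discreteL n ε A x t (fun i j k => -Ψ i j k) i j k = -discreteL n ε A x t Ψ i j k := by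
  simp only [discreteL, mul_neg, Finset.sum_neg_distrib]
  ring

/-- At an interior point where a component of the mesh function is nonnegative and dominates its
neighbours and the other components, the discrete operator is at least `α` times its value. -/
theorem mul_le_discreteL_of_max {n : ℕ} {ε : ℕ → ℝ} {A : ℕ → ℕ → ℝ → ℝ → ℝ}
    {x t : ℕ → ℝ} {Ψ : ℕ → ℕ → ℕ → ℝ} {i j k : ℕ} {α : ℝ} (hε : 0 ≤ ε i)
    (ht : t (k - 1) ≤ t k) (hxl : x (j - 1) ≤ x j) (hxr : x j ≤ x (j + 1))
    (hoff : ∀ l ∈ Finset.Icc 1 n, i ≠ l → A i l (x j) (t k) ≤ 0)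
    (hα : α ≤ ∑ l ∈ Finset.Icc 1 n, A i l (x j) (t k))
    (hnonneg : 0 ≤ Ψ i j k) (htime : Ψ i j (k - 1) ≤ Ψ i j k)
    (hleft : Ψ i (j - 1) k ≤ Ψ i j k) (hright : Ψ i (j + 1) k ≤ Ψ i j k)
    (hcomp : ∀ l ∈ Finset.Icc 1 n, Ψ l j k ≤ Ψ i j k) :
    α * Ψ i j k ≤ discreteL n ε A x t Ψ i j k := by
  have h_time : 0 ≤ (Ψ i j k - Ψ i j (k - 1)) / (t k - t (k - 1)) :=
    div_nonneg (by linarith) (by linarith)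
  have h_right : (Ψ i (j + 1) k - Ψ i j k) / (x (j + 1) - x j) ≤ 0 :=
    div_nonpos_of_nonpos_of_nonneg (by linarith) (by linarith)
  have h_left : 0 ≤ (Ψ i j k - Ψ i (j - 1) k) / (x j - x (j - 1)) :=
    div_nonneg (by linarith) (by linarith)
  have h_space : ε i * (((Ψ i (j + 1) k - Ψ i j k) / (x (j + 1) - x j)
      - (Ψ i j k - Ψ i (j - 1) k) / (x j - x (j - 1)))
        / ((x (j + 1) - x (j - 1)) / 2)) ≤ 0 :=
    mul_nonpos_of_nonneg_of_nonpos hε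
      (div_nonpos_of_nonpos_of_nonneg (by linarith) (by linarith))
  have h_sum : α * Ψ i j k ≤ ∑ l ∈ Finset.Icc 1 n, A i l (x j) (t k) * Ψ l j k := by
    refine (mul_le_mul_of_nonneg_right hα hnonneg).trans ?_
    rw [Finset.sum_mul]
    refine Finset.sum_le_sum fun l hl => ?_
    rcases eq_or_ne i l with rfl | hil
    · exact le_rfl
    · exact mul_le_mul_of_nonpos_left (hcomp l hl) (hoff l hl hil)
  unfold discreteL
  linarith

/-- **Discrete stability** (Lemma 10 of the paper): for every bound `KΓ` on
`max_i |Ψ_i|` over the boundary mesh points and every bound `KL` on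
`max_i |(L^{M,N}Ψ)_i|` over the interior mesh points,
`|Ψ_i(x_j,t_k)| ≤ max {KΓ, (1/α)·KL}` at every mesh point; this is the
least-upper-bound formulation of
`max_i |Ψ_i| ≤ max {‖Ψ‖_{Γ^{M,N}}, (1/α)‖L^{M,N}Ψ‖}`. -/
theorem stmt_16
    (n : ℕ) (hn : 1 ≤ n) (T : ℝ) (hT : 0 < T)
    (ε : ℕ → ℝ)
    (hε0 : ∀ i ∈ Finset.Icc 1 n, 0 < ε i)
    (hε1 : ∀ i ∈ Finset.Icc 1 n, ε i ≤ 1)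
    (hεmono : ∀ i j : ℕ, 1 ≤ i → i < j → j ≤ n → ε i < ε j)
    (N M : ℕ) (hN : 1 ≤ N) (hM : 1 ≤ M)
    (x : ℕ → ℝ) (hx0 : x 0 = 0) (hxN : x N = 1)
    (hxmono : ∀ j j' : ℕ, j < j' → j' ≤ N → x j < x j')
    (t : ℕ → ℝ) (ht0 : t 0 = 0) (htM : t M = T)
    (htmono : ∀ k k' : ℕ, k < k' → k' ≤ M → t k < t k')
    (A : ℕ → ℕ → ℝ → ℝ → ℝ)
    (hAdiag : ∀ i ∈ Finset.Icc 1 n, ∀ j ≤ N, ∀ k ≤ M,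
      ∑ l ∈ (Finset.Icc 1 n).erase i, |A i l (x j) (t k)| < A i i (x j) (t k))
    (hAoff : ∀ i ∈ Finset.Icc 1 n, ∀ l ∈ Finset.Icc 1 n, i ≠ l →
      ∀ j ≤ N, ∀ k ≤ M, A i l (x j) (t k) ≤ 0)
    (α : ℝ) (hα : 0 < α)
    (hαA : ∀ j ≤ N, ∀ k ≤ M, ∀ i ∈ Finset.Icc 1 n,
      α < ∑ l ∈ Finset.Icc 1 n, A i l (x j) (t k))
    (Ψ : ℕ → ℕ → ℕ → ℝ)
    (KΓ KL : ℝ)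
    (hKΓ : ∀ i ∈ Finset.Icc 1 n, ∀ j ≤ N, ∀ k ≤ M,
      (j = 0 ∨ j = N ∨ k = 0) → |Ψ i j k| ≤ KΓ)
    (hKL : ∀ i ∈ Finset.Icc 1 n, ∀ j k : ℕ, 0 < j → j < N → 0 < k → k ≤ M →
      |discreteL n ε A x t Ψ i j k| ≤ KL) :
    ∀ i ∈ Finset.Icc 1 n, ∀ j ≤ N, ∀ k ≤ M,
      |Ψ i j k| ≤ max KΓ ((1 / α) * KL) := by
  intro i₀ hi₀ j₀ hj₀ k₀ hk₀
  obtain ⟨⟨i, j, k⟩, hmem, hmax⟩ := Finset.exists_max_image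
    (Finset.Icc 1 n ×ˢ Finset.range (N + 1) ×ˢ Finset.range (M + 1))
    (fun p => |Ψ p.1 p.2.1 p.2.2|)
    ⟨(i₀, j₀, k₀), Finset.mk_mem_product hi₀
      (Finset.mk_mem_product (Finset.mem_range_succ_iff.mpr hj₀) (Finset.mem_range_succ_iff.mpr hk₀))⟩
  simp only [Finset.mem_product, Finset.mem_range, Order.lt_add_one_iff] at hmem
  obtain ⟨hi, hj, hk⟩ := hmem
  have hle : ∀ i' ∈ Finset.Icc 1 n, ∀ j' ≤ N, ∀ k' ≤ M, |Ψ i' j' k'| ≤ |Ψ i j k| :=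
    fun i' hi' j' hj' k' hk' => hmax (i', j', k') (Finset.mk_mem_product hi'
      (Finset.mk_mem_product (Finset.mem_range_succ_iff.mpr hj') (Finset.mem_range_succ_iff.mpr hk')))
  refine (hle i₀ hi₀ j₀ hj₀ k₀ hk₀).trans ?_
  by_cases hbd : j = 0 ∨ j = N ∨ k = 0
  · exact (hKΓ i hi j hj k hk hbd).trans (le_max_left _ _)
  push Not at hbd
  obtain ⟨hj0, hjN, hk0⟩ := hbd
  refine le_trans ?_ (le_max_right _ _)
  have hL := hKL i hi j k (by omega) (by omega) (by omega) hk
  suffices h : α * |Ψ i j k| ≤ |discreteL n ε A x t Ψ i j k| by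
    rw [one_div, inv_mul_eq_div, le_div_iff₀ hα, mul_comm]
    exact h.trans hL
  -- The one-sided estimate, for either of the two mesh functions `Ψ` and `-Ψ`.
  have key : ∀ Φ : ℕ → ℕ → ℕ → ℝ, (∀ i j k, |Φ i j k| = |Ψ i j k|) → 0 ≤ Φ i j k →
      α * Φ i j k ≤ discreteL n ε A x t Φ i j k := by
    intro Φ hΦ hnonneg
    have hΦle : ∀ i' ∈ Finset.Icc 1 n, ∀ j' ≤ N, ∀ k' ≤ M, Φ i' j' k' ≤ Φ i j k := by
      intro i' hi' j' hj' k' hk'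
      have h := hle i' hi' j' hj' k' hk'
      rw [← hΦ, ← hΦ, abs_of_nonneg hnonneg] at h
      exact (le_abs_self _).trans h
    exact mul_le_discreteL_of_max (hε0 i hi).le
      (htmono _ _ (by omega) hk).le (hxmono _ _ (by omega) hj).le
      (hxmono _ _ (by omega) (by omega)).le
      (fun l hl hil => hAoff i hi l hl hil j hj k hk) (hαA j hj k hk i hi).le hnonneg
      (hΦle i hi j hj _ (by omega)) (hΦle i hi _ (by omega) k hk)
      (hΦle i hi _ (by omega) k hk) (fun l hl => hΦle l hl j hj k hk)
  rcases le_total 0 (Ψ i j k) with h | h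
  · rw [abs_of_nonneg h]
    exact (key Ψ (fun _ _ _ => rfl) h).trans (le_abs_self _)
  · rw [abs_of_nonpos h]
    have h' := key (fun i j k => -Ψ i j k) (fun _ _ _ => abs_neg _) (neg_nonneg.mpr h)
    rw [discreteL_neg] at h'
    exact h'.trans (neg_le_abs _)
end
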